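/- arXiv:1107.1885 — 9 statements merged into one kernel-verified Lean document; each statement's English description precedes it below -/
import Mathlib

section
/- (1-Gehring implies p-Gehring.) Let 1 < p < ∞ and let w be a weight on ℝ^n with finite Reverse Hölder constant [w]_{RH_p} (over cubes). Then sup_I ⟨(w^p/⟨w^p⟩_I)·log(e + w^p/⟨w^p⟩_I)⟩_I ≤ 6^n · 2^p · (p/(p−1)) · [w]_{RH_p}^p, the supremum over all axis-parallel cubes I ⊂ ℝ^n; that is, w^p belongs to RH_1 with the stated bound on its RH_1 constant. -/
open MeasureTheory Real

/-- The axis-parallel cube in `ℝⁿ` with corner `c` and side length `h`. -/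
def cube {n : ℕ} (c : Fin n → ℝ) (h : ℝ) : Set (Fin n → ℝ) :=
  Set.univ.pi fun i => Set.Icc (c i) (c i + h)

/-- The average `⟨f⟩_I = |I|⁻¹ ∫_I f` of a function over the cube with corner `c`
and side length `h`. -/
noncomputable def cubeAvg {n : ℕ} (f : (Fin n → ℝ) → ℝ) (c : Fin n → ℝ) (h : ℝ) : ℝ :=
  (volume (cube c h)).toReal⁻¹ * ∫ x in cube c h, f x

open Filter Set
open scoped ENNReal Topology

/-- The half-open axis-parallel cube with corner `c` and side length `h`. -/
def icoCube {n : ℕ} (c : Fin n → ℝ) (h : ℝ) : Set (Fin n → ℝ) :=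
  Set.univ.pi fun i => Set.Ico (c i) (c i + h)

section Cubes

variable {n : ℕ}

lemma measurableSet_icoCube (c : Fin n → ℝ) (h : ℝ) : MeasurableSet (icoCube c h) :=
  MeasurableSet.univ_pi fun _ => measurableSet_Ico

lemma volume_icoCube (c : Fin n → ℝ) (h : ℝ) :
    volume (icoCube c h) = ENNReal.ofReal h ^ n := by
  simp [icoCube, Real.volume_pi_Ico]

lemma cube_eq_Icc (c : Fin n → ℝ) (h : ℝ) : cube c h = Icc c (fun i => c i + h) :=
  Set.pi_univ_Icc _ _

lemma icoCube_ae_eq_cube (c : Fin n → ℝ) (h : ℝ) :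
    icoCube c h =ᵐ[volume] cube c h := by
  rw [cube_eq_Icc]
  exact Measure.univ_pi_Ico_ae_eq_Icc

lemma cube_eq_closedBall (c : Fin n → ℝ) {h : ℝ} (hh : 0 ≤ h) :
    cube c h = Metric.closedBall (fun i => c i + h / 2) (h / 2) := by
  rw [closedBall_pi _ (by positivity)]
  simp only [cube, Real.closedBall_eq_Icc]
  congr! 3 <;> ring

lemma integrableOn_icoCube {f : (Fin n → ℝ) → ℝ} (hf : LocallyIntegrable f) (c : Fin n → ℝ)
    (h : ℝ) : IntegrableOn f (icoCube c h) := by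
  rw [integrableOn_congr_set_ae (icoCube_ae_eq_cube c h), cube_eq_Icc]
  exact hf.integrableOn_isCompact isCompact_Icc

/-- The corner of the dyadic child of a cube selected by `ε`. -/
noncomputable def childCorner (c : Fin n → ℝ) (h : ℝ) (ε : Fin n → Bool) : Fin n → ℝ :=
  fun i => c i + if ε i then h / 2 else 0

lemma mem_child_iff {c x : Fin n → ℝ} {h : ℝ} {ε : Fin n → Bool} :
    x ∈ icoCube (childCorner c h ε) (h / 2) ∧ 0 < h ↔
      x ∈ icoCube c h ∧ 0 < h ∧ ε = fun i => decide (c i + h / 2 ≤ x i) := by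
  simp only [icoCube, childCorner, Set.mem_univ_pi, Set.mem_Ico, funext_iff]
  constructor
  · rintro ⟨h1, hh⟩
    refine ⟨fun i => ?_, hh, fun i => ?_⟩ <;> have := h1 i <;> cases hε : ε i <;>
      simp [hε] at this ⊢
    all_goals first | linarith | (constructor <;> linarith)
  · rintro ⟨h1, hh, h2⟩
    refine ⟨fun i => ?_, hh⟩
    have h1 := h1 i
    rw [h2 i]
    by_cases hc : c i + h / 2 ≤ x i
    · simp only [hc, decide_true, if_true, true_and]; linarith
    · simp only [hc, decide_false]
      push Not at hc
      constructor <;> simp <;> linarith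

lemma iUnion_child (c : Fin n → ℝ) {h : ℝ} (hh : 0 < h) :
    ⋃ ε, icoCube (childCorner c h ε) (h / 2) = icoCube c h := by
  ext x
  simp only [mem_iUnion]
  constructor
  · rintro ⟨ε, hx⟩
    exact (mem_child_iff.1 ⟨hx, hh⟩).1
  · intro hx
    exact ⟨_, (mem_child_iff.2 ⟨hx, hh, rfl⟩).1⟩

lemma pairwise_disjoint_child (c : Fin n → ℝ) {h : ℝ} (hh : 0 < h) :
    Pairwise (Function.onFun Disjoint fun ε => icoCube (childCorner c h ε) (h / 2)) := by
  intro ε ε' hne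
  refine Set.disjoint_left.2 fun x hx hx' => hne ?_
  rw [(mem_child_iff.1 ⟨hx, hh⟩).2.2, (mem_child_iff.1 ⟨hx', hh⟩).2.2]

lemma two_pow_mul_volume_child (c c' : Fin n → ℝ) (h : ℝ) :
    2 ^ n * volume (icoCube c' (h / 2)) = volume (icoCube c h) := by
  rw [volume_icoCube, volume_icoCube, ← mul_pow, ENNReal.ofReal_div_of_pos two_pos]
  congr 1
  rw [ENNReal.ofReal_ofNat]
  exact ENNReal.mul_div_cancel (by norm_num) (by norm_num)

/-- Calderón–Zygmund stopping-time selection run for `k` generations: either the mass of `F` has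
been absorbed by `G`, or the point lies in a small cube on which the average of `F` is at most
`t`. -/
lemma exists_unstopped_set {F G : (Fin n → ℝ) → ℝ≥0∞} {t : ℝ≥0∞}
    (H : ∀ (c : Fin n → ℝ) (h : ℝ), 0 < h →
      t * volume (icoCube c h) < ∫⁻ x in icoCube c h, F x →
      2 ^ n * t * volume (icoCube c h) ≤ ∫⁻ x in icoCube c h, G x) (k : ℕ) :
    ∀ (c : Fin n → ℝ) (h : ℝ), 0 < h →
      ∫⁻ x in icoCube c h, F x ≤ t * volume (icoCube c h) →
      ∃ A : Set (Fin n → ℝ), MeasurableSet A ∧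
        ∫⁻ x in icoCube c h \ A, F x ≤ ∫⁻ x in icoCube c h, G x ∧
        ∀ x ∈ A, ∃ c', x ∈ icoCube c' (h / 2 ^ k) ∧
          ∫⁻ y in icoCube c' (h / 2 ^ k), F y ≤ t * volume (icoCube c' (h / 2 ^ k)) := by
  induction k with
  | zero =>
    intro c h hh hQ
    exact ⟨icoCube c h, measurableSet_icoCube c h, by simp, fun x hx =>
      ⟨c, by simpa using hx, by simpa using hQ⟩⟩
  | succ k ih =>
    intro c h hh hQ
    have key : ∀ ε : Fin n → Bool, ∃ A : Set (Fin n → ℝ), MeasurableSet A ∧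
        ∫⁻ x in icoCube (childCorner c h ε) (h / 2) \ A, F x ≤
          ∫⁻ x in icoCube (childCorner c h ε) (h / 2), G x ∧
        ∀ x ∈ A, ∃ c', x ∈ icoCube c' (h / 2 ^ (k + 1)) ∧
          ∫⁻ y in icoCube c' (h / 2 ^ (k + 1)), F y ≤
            t * volume (icoCube c' (h / 2 ^ (k + 1))) := by
      intro ε
      by_cases hε : ∫⁻ x in icoCube (childCorner c h ε) (h / 2), F x ≤
          t * volume (icoCube (childCorner c h ε) (h / 2))
      · have := ih (childCorner c h ε) (h / 2) (by positivity) hε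
        have e : h / 2 / 2 ^ k = h / 2 ^ (k + 1) := by rw [pow_succ]; field_simp
        rwa [e] at this
      · refine ⟨∅, MeasurableSet.empty, ?_, by simp⟩
        rw [sdiff_empty]
        calc ∫⁻ x in icoCube (childCorner c h ε) (h / 2), F x
            ≤ ∫⁻ x in icoCube c h, F x := by
              apply lintegral_mono_set
              rw [← iUnion_child c hh]
              exact subset_iUnion_of_subset ε subset_rfl
          _ ≤ t * volume (icoCube c h) := hQ
          _ = 2 ^ n * t * volume (icoCube (childCorner c h ε) (h / 2)) := by
              rw [← two_pow_mul_volume_child c (childCorner c h ε) h]; ring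
          _ ≤ _ := H _ _ (by positivity) (not_le.1 hε)
    choose A hAm hAF hA using key
    refine ⟨⋃ ε, A ε, MeasurableSet.iUnion hAm, ?_, ?_⟩
    · calc ∫⁻ x in icoCube c h \ ⋃ ε, A ε, F x
          ≤ ∫⁻ x in ⋃ ε, (icoCube (childCorner c h ε) (h / 2) \ A ε), F x := by
            apply lintegral_mono_set
            rintro x ⟨hx, hxA⟩
            rw [← iUnion_child c hh] at hx
            obtain ⟨ε, hx⟩ := mem_iUnion.1 hx
            exact mem_iUnion.2 ⟨ε, hx, fun h' => hxA (mem_iUnion.2 ⟨ε, h'⟩)⟩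
        _ ≤ ∑' ε, ∫⁻ x in icoCube (childCorner c h ε) (h / 2) \ A ε, F x :=
            lintegral_iUnion_le _ _
        _ ≤ ∑' ε, ∫⁻ x in icoCube (childCorner c h ε) (h / 2), G x :=
            ENNReal.tsum_le_tsum hAF
        _ = ∫⁻ x in icoCube c h, G x := by
            rw [← lintegral_iUnion (fun ε => measurableSet_icoCube _ _)
              (pairwise_disjoint_child c hh), iUnion_child c hh]
    · intro x hx
      obtain ⟨ε, hx⟩ := mem_iUnion.1 hx
      exact hA ε x hx

lemma volume_icoCube_ne_zero (c : Fin n → ℝ) {h : ℝ} (hh : 0 < h) :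
    volume (icoCube c h) ≠ 0 := by
  rw [volume_icoCube]
  exact pow_ne_zero _ (by simpa using hh)

lemma volume_icoCube_ne_top (c : Fin n → ℝ) (h : ℝ) : volume (icoCube c h) ≠ ∞ := by
  rw [volume_icoCube]
  exact ENNReal.pow_ne_top ENNReal.ofReal_ne_top

lemma cubeAvg_eq_setAverage (f : (Fin n → ℝ) → ℝ) (c : Fin n → ℝ) (h : ℝ) :
    cubeAvg f c h = ⨍ x in icoCube c h, f x := by
  rw [setAverage_congr (icoCube_ae_eq_cube c h), setAverage_eq, smul_eq_mul, measureReal_def,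
    cubeAvg]

lemma ofReal_cubeAvg_mul_volume {f : (Fin n → ℝ) → ℝ} (hf : LocallyIntegrable f)
    (hf0 : ∀ x, 0 ≤ f x) (c : Fin n → ℝ) (h : ℝ) :
    ENNReal.ofReal (cubeAvg f c h) * volume (icoCube c h) =
      ∫⁻ y in icoCube c h, ENNReal.ofReal (f y) := by
  rw [cubeAvg_eq_setAverage, ← ofReal_integral_eq_lintegral_ofReal (integrableOn_icoCube hf c h)
    (ae_of_all _ hf0), ← measure_smul_setAverage f (volume_icoCube_ne_top c h), smul_eq_mul,
    ENNReal.ofReal_mul measureReal_nonneg,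
    ofReal_measureReal (volume_icoCube_ne_top c h), mul_comm]

/-- Calderón–Zygmund estimate at level `t` inside a cube on which the average of `f` is at
most `t`. -/
lemma setLIntegral_superlevel_le {f : (Fin n → ℝ) → ℝ} (hfm : Measurable f)
    (hf : LocallyIntegrable f) (hf0 : ∀ x, 0 ≤ f x) {G : (Fin n → ℝ) → ℝ≥0∞} {t : ℝ}
    (ht : 0 ≤ t)
    (H : ∀ (c : Fin n → ℝ) (h : ℝ), 0 < h →
      ENNReal.ofReal t * volume (icoCube c h) < ∫⁻ x in icoCube c h, ENNReal.ofReal (f x) →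
      2 ^ n * ENNReal.ofReal t * volume (icoCube c h) ≤ ∫⁻ x in icoCube c h, G x)
    (c : Fin n → ℝ) {h : ℝ} (hh : 0 < h)
    (hQ : ∫⁻ x in icoCube c h, ENNReal.ofReal (f x) ≤ ENNReal.ofReal t * volume (icoCube c h)) :
    ∫⁻ x in icoCube c h, {x | t < f x}.indicator (fun x => ENNReal.ofReal (f x)) x ≤
      ∫⁻ x in icoCube c h, G x := by
  choose A hAm hAF hA using fun k => exists_unstopped_set H k c h hh hQ
  have hSm : MeasurableSet {x | t < f x} := measurableSet_lt measurable_const hfm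
  have hFm : Measurable fun x => ENNReal.ofReal (f x) := hfm.ennreal_ofReal
  have hlim : Tendsto (fun k => ∫⁻ x in icoCube c h,
      (A k ∩ {x | t < f x}).indicator (fun x => ENNReal.ofReal (f x)) x) atTop (𝓝 0) := by
    have := tendsto_lintegral_of_dominated_convergence (μ := volume.restrict (icoCube c h))
      (F := fun k => (A k ∩ {x | t < f x}).indicator (fun x => ENNReal.ofReal (f x)))
      (f := fun _ => 0) (fun x => ENNReal.ofReal (f x))
      (fun k => hFm.indicator ((hAm k).inter hSm))
      (fun k => ae_of_all _ fun x => Set.indicator_le_self _ _ x)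
      (integrableOn_icoCube hf c h).lintegral_lt_top.ne ?_
    · simpa using this
    · refine ae_restrict_of_ae ?_
      filter_upwards [IsUnifLocDoublingMeasure.ae_tendsto_average volume hf 1] with x hx
      refine tendsto_const_nhds.congr' ?_
      by_cases hxt : t < f x
      · have hc : ∀ k, ∃ c', x ∈ cube c' (h / 2 ^ k) ∧ (x ∈ A k →
            ∫⁻ y in icoCube c' (h / 2 ^ k), ENNReal.ofReal (f y) ≤
              ENNReal.ofReal t * volume (icoCube c' (h / 2 ^ k))) := by
          intro k
          by_cases hk : x ∈ A k
          · obtain ⟨c', h1, h2⟩ := hA k x hk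
            exact ⟨c', Set.pi_mono (fun i _ => Ico_subset_Icc_self) h1, fun _ => h2⟩
          · refine ⟨x, ?_, fun h' => absurd h' hk⟩
            rw [cube_eq_Icc]
            exact ⟨le_rfl, fun i => le_add_of_nonneg_right (by positivity)⟩
        choose c' hc1 hc2 using hc
        have hδ : Tendsto (fun k : ℕ => h / 2 ^ k / 2) atTop (𝓝[>] 0) := by
          refine tendsto_nhdsWithin_iff.2 ⟨?_, Eventually.of_forall fun k => ?_⟩
          · have := (tendsto_pow_atTop_nhds_zero_of_lt_one (r := (1 / 2 : ℝ)) (by norm_num)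
              (by norm_num)).const_mul (h / 2)
            rw [mul_zero] at this
            refine this.congr fun k => ?_
            rw [one_div, inv_pow]; ring
          · exact mem_Ioi.2 (by positivity)
        have := hx (fun k i => c' k i + h / 2 ^ k / 2) (fun k : ℕ => h / 2 ^ k / 2) hδ
          (Eventually.of_forall fun k => by
            rw [one_mul, ← cube_eq_closedBall _ (by positivity)]; exact hc1 k)
        filter_upwards [this.eventually (lt_mem_nhds hxt)] with k hk
        rw [Set.indicator_of_notMem]
        rintro ⟨hkA, -⟩
        have h3 := hc2 k hkA
        rw [← cube_eq_closedBall _ (by positivity), ← setAverage_congr (icoCube_ae_eq_cube _ _),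
          ← cubeAvg_eq_setAverage] at hk
        rw [← ofReal_cubeAvg_mul_volume hf hf0 _ _] at h3
        exact absurd h3 (not_le.2 (ENNReal.mul_lt_mul_left
          (volume_icoCube_ne_zero _ (by positivity)) (volume_icoCube_ne_top _ _)
          ((ENNReal.ofReal_lt_ofReal_iff (ht.trans_lt hk)).2 hk)))
      · refine Eventually.of_forall fun k => ?_
        exact (Set.indicator_of_notMem (fun h' => hxt h'.2) _).symm
  have hle : ∀ k, ∫⁻ x in icoCube c h, {x | t < f x}.indicator (fun x => ENNReal.ofReal (f x)) x ≤
      (∫⁻ x in icoCube c h, G x) + ∫⁻ x in icoCube c h,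
        (A k ∩ {x | t < f x}).indicator (fun x => ENNReal.ofReal (f x)) x := by
    intro k
    refine le_trans ?_ (add_le_add_left (hAF k) _)
    have e : ∫⁻ x in icoCube c h \ A k, ENNReal.ofReal (f x) =
        ∫⁻ x in icoCube c h, (A k)ᶜ.indicator (fun x => ENNReal.ofReal (f x)) x := by
      rw [lintegral_indicator (hAm k).compl, Measure.restrict_restrict (hAm k).compl,
        inter_comm, sdiff_eq]
    rw [e, ← lintegral_add_left (hFm.indicator (hAm k).compl)]
    refine lintegral_mono fun x => ?_
    by_cases h1 : x ∈ A k <;> by_cases h2 : t < f x <;> simp [Set.indicator, h1, h2]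
  have := ge_of_tendsto' (hlim.const_add (∫⁻ x in icoCube c h, G x)) hle
  simpa using this

/-- Weak-type estimate: a lower bound on the average of `W` passes to its part above half of
that bound. -/
lemma volume_le_setLIntegral_superlevel {W : (Fin n → ℝ) → ℝ} (hWm : Measurable W)
    {s : ℝ} (hs : 0 < s) {c : Fin n → ℝ} {h : ℝ}
    (hQ : ENNReal.ofReal s * volume (icoCube c h) ≤ ∫⁻ x in icoCube c h, ENNReal.ofReal (W x)) :
    ENNReal.ofReal (s / 2) * volume (icoCube c h) ≤
      ∫⁻ x in icoCube c h, {x | s / 2 < W x}.indicator (fun x => ENNReal.ofReal (W x)) x := by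
  have hfin : ENNReal.ofReal (s / 2) * volume (icoCube c h) ≠ ∞ :=
    ENNReal.mul_ne_top ENNReal.ofReal_ne_top (volume_icoCube_ne_top c h)
  have hSm : MeasurableSet {x | s / 2 < W x} := measurableSet_lt measurable_const hWm
  refine (ENNReal.add_le_add_iff_right hfin).1 ?_
  calc ENNReal.ofReal (s / 2) * volume (icoCube c h) + ENNReal.ofReal (s / 2) *
        volume (icoCube c h)
      = ENNReal.ofReal s * volume (icoCube c h) := by
        rw [← add_mul, ← ENNReal.ofReal_add (by positivity) (by positivity), add_halves]
    _ ≤ ∫⁻ x in icoCube c h, ENNReal.ofReal (W x) := hQ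
    _ ≤ ∫⁻ x in icoCube c h, ({x | s / 2 < W x}.indicator (fun x => ENNReal.ofReal (W x)) x
          + ENNReal.ofReal (s / 2)) := by
        refine lintegral_mono fun x => ?_
        by_cases hx : s / 2 < W x
        · simp [Set.indicator, hx]
        · simpa [Set.indicator, hx] using ENNReal.ofReal_le_ofReal (not_lt.1 hx)
    _ = _ := by
        rw [lintegral_add_right _ measurable_const, setLIntegral_const]

lemma setLIntegral_rpow_superlevel_le {p : ℝ} (hp : 1 < p) {W : (Fin n → ℝ) → ℝ}
    (hWm : Measurable W) (hW0 : ∀ x, 0 < W x) (hWp : LocallyIntegrable fun x => W x ^ p)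
    {C : ℝ} (hC0 : 0 < C)
    (hRH : ∀ (c : Fin n → ℝ) (h t : ℝ), 0 < h → 0 < t →
      ENNReal.ofReal t * volume (icoCube c h) < ∫⁻ x in icoCube c h, ENNReal.ofReal (W x ^ p) →
      ENNReal.ofReal (t ^ (1 / p) / C) * volume (icoCube c h) ≤
        ∫⁻ x in icoCube c h, ENNReal.ofReal (W x))
    (c : Fin n → ℝ) {h t : ℝ} (hh : 0 < h) (ht : 0 < t)
    (hQ : ∫⁻ x in icoCube c h, ENNReal.ofReal (W x ^ p) ≤
      ENNReal.ofReal t * volume (icoCube c h)) :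
    ∫⁻ x in icoCube c h, {x | t < W x ^ p}.indicator (fun x => ENNReal.ofReal (W x ^ p)) x ≤
      ∫⁻ x in icoCube c h, {x | t < (2 * C * W x) ^ p}.indicator
        (fun x => ENNReal.ofReal (2 ^ n * (2 * C) * t ^ (1 - 1 / p) * W x)) x := by
  have hp0 : 0 < p := one_pos.trans hp
  refine setLIntegral_superlevel_le (hWm.pow_const p) hWp (fun x => (rpow_pos_of_pos (hW0 x) p).le)
    ht.le (fun c h hh hlt => ?_) c hh hQ
  have hs : 0 < t ^ (1 / p) / C := by positivity
  have h1 := volume_le_setLIntegral_superlevel hWm hs (hRH c h t hh ht hlt)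
  have hset : {x | t ^ (1 / p) / C / 2 < W x} = {x | t < (2 * C * W x) ^ p} := by
    ext x
    have : 0 < 2 * C * W x := mul_pos (by positivity) (hW0 x)
    rw [mem_ofPred_eq, mem_ofPred_eq, ← rpow_inv_lt_iff_of_pos ht.le this.le hp0, ← one_div,
      div_div, div_lt_iff₀ (by positivity)]
    constructor <;> intro h' <;> linarith
  have hK : 0 ≤ 2 ^ n * (2 * C) * t ^ (1 - 1 / p) := by positivity
  calc 2 ^ n * ENNReal.ofReal t * volume (icoCube c h)
      = ENNReal.ofReal (2 ^ n * (2 * C) * t ^ (1 - 1 / p)) *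
          (ENNReal.ofReal (t ^ (1 / p) / C / 2) * volume (icoCube c h)) := by
        rw [← mul_assoc, ← ENNReal.ofReal_mul hK]
        have : 2 ^ n * (2 * C) * t ^ (1 - 1 / p) * (t ^ (1 / p) / C / 2) = 2 ^ n * t := by
          have e : t ^ (1 - 1 / p) * t ^ (1 / p) = t := by
            rw [← rpow_add ht, sub_add_cancel, rpow_one]
          calc _ = 2 ^ n * (t ^ (1 - 1 / p) * t ^ (1 / p)) := by field_simp
            _ = _ := by rw [e]
        rw [this, ENNReal.ofReal_mul (by positivity), ENNReal.ofReal_pow (by positivity),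
          ENNReal.ofReal_ofNat]
    _ ≤ ENNReal.ofReal (2 ^ n * (2 * C) * t ^ (1 - 1 / p)) *
          ∫⁻ x in icoCube c h, {x | t ^ (1 / p) / C / 2 < W x}.indicator
            (fun x => ENNReal.ofReal (W x)) x := by gcongr
    _ = _ := by
        rw [← lintegral_const_mul' _ _ ENNReal.ofReal_ne_top, hset]
        refine lintegral_congr fun x => ?_
        simp only [Set.indicator, mul_ite, mul_zero, ← ENNReal.ofReal_mul hK]

lemma ofReal_log_div_le_setLIntegral {a y : ℝ} (ha : 0 < a) (hy0 : 0 < y) :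
    ENNReal.ofReal (Real.log (y / a)) ≤ ∫⁻ t in Ioi a,
      {t | t < y}.indicator (fun t => ENNReal.ofReal t⁻¹) t := by
  rcases le_or_gt y a with hy | hy
  · rw [ENNReal.ofReal_of_nonpos]
    · exact zero_le
    · exact Real.log_nonpos (by positivity) ((div_le_one ha).2 hy)
  · have hab : a ≤ y := hy.le
    have hi : IntervalIntegrable (fun t : ℝ => t⁻¹) volume a y :=
      intervalIntegral.intervalIntegrable_inv (fun t ht => by
        rw [uIcc_of_le hab] at ht; exact (ha.trans_le ht.1).ne') continuousOn_id
    rw [← integral_inv_of_pos ha hy0, intervalIntegral.integral_of_le hab,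
      ofReal_integral_eq_lintegral_ofReal ((intervalIntegrable_iff_integrableOn_Ioc_of_le hab).1 hi)
        ((ae_restrict_iff' measurableSet_Ioc).2 (ae_of_all _ fun t ht =>
          inv_nonneg.2 (ha.trans ht.1).le)),
      lintegral_indicator (s := {t | t < y}) measurableSet_Iio,
      Measure.restrict_restrict (s := {t | t < y}) measurableSet_Iio,
      ← restrict_Ioo_eq_restrict_Ioc]
    exact (lintegral_mono_set fun t ht => ⟨ht.2, ht.1⟩)

lemma setLIntegral_rpow_neg_le {p : ℝ} (hp : 1 < p) {a b : ℝ} (ha : 0 < a) (hb : 0 < b) :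
    ∫⁻ t in Ioi a, {t | t < b ^ p}.indicator (fun t => ENNReal.ofReal (t ^ (-(1 / p)))) t ≤
      ENNReal.ofReal (b ^ (p - 1) * (p / (p - 1))) := by
  have hp0 : 0 < p := one_pos.trans hp
  have h1p : 1 / p < 1 := (div_lt_one hp0).2 hp
  have hbp : 0 ≤ b ^ p := by positivity
  have hr : -1 < -(1 / p) := by linarith
  have hi := intervalIntegral.intervalIntegrable_rpow' (a := 0) (b := b ^ p) hr
  have hval : ∫ t in (0 : ℝ)..b ^ p, t ^ (-(1 / p)) = b ^ (p - 1) * (p / (p - 1)) := by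
    rw [integral_rpow (Or.inl hr), zero_rpow (by linarith), sub_zero, ← rpow_mul hb.le]
    have e : p * (-(1 / p) + 1) = p - 1 := by field_simp; ring
    have e' : -(1 / p) + 1 = (p - 1) / p := by field_simp; ring
    rw [e, e', div_div_eq_mul_div, mul_div_assoc]
  rw [← hval, intervalIntegral.integral_of_le hbp,
    ofReal_integral_eq_lintegral_ofReal ((intervalIntegrable_iff_integrableOn_Ioc_of_le hbp).1 hi)
      ((ae_restrict_iff' measurableSet_Ioc).2 (ae_of_all _ fun t ht => rpow_nonneg ht.1.le _)),
    lintegral_indicator (s := {t | t < b ^ p}) measurableSet_Iio,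
    Measure.restrict_restrict (s := {t | t < b ^ p}) measurableSet_Iio]
  exact lintegral_mono_set fun t ht => ⟨ha.trans ht.2, (le_of_lt ht.1)⟩

lemma setLIntegral_rpow_mul_log_le {p : ℝ} (hp : 1 < p) {W : (Fin n → ℝ) → ℝ}
    (hWm : Measurable W) (hW0 : ∀ x, 0 < W x) (hWp : LocallyIntegrable fun x => W x ^ p)
    {C : ℝ} (hC0 : 0 < C)
    (hRH : ∀ (c : Fin n → ℝ) (h t : ℝ), 0 < h → 0 < t →
      ENNReal.ofReal t * volume (icoCube c h) < ∫⁻ x in icoCube c h, ENNReal.ofReal (W x ^ p) →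
      ENNReal.ofReal (t ^ (1 / p) / C) * volume (icoCube c h) ≤
        ∫⁻ x in icoCube c h, ENNReal.ofReal (W x))
    (c : Fin n → ℝ) {h a : ℝ} (hh : 0 < h) (ha : 0 < a)
    (hQ : ∫⁻ x in icoCube c h, ENNReal.ofReal (W x ^ p) ≤
      ENNReal.ofReal a * volume (icoCube c h)) :
    ∫⁻ x in icoCube c h, ENNReal.ofReal (W x ^ p) * ENNReal.ofReal (Real.log (W x ^ p / a)) ≤
      ENNReal.ofReal (2 ^ n * (2 * C) ^ p * (p / (p - 1))) *
        ∫⁻ x in icoCube c h, ENNReal.ofReal (W x ^ p) := by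
  have hp0 : 0 < p := one_pos.trans hp
  have hWpm : Measurable fun x => W x ^ p := hWm.pow_const p
  calc ∫⁻ x in icoCube c h, ENNReal.ofReal (W x ^ p) * ENNReal.ofReal (Real.log (W x ^ p / a))
      ≤ ∫⁻ x in icoCube c h, ∫⁻ t in Ioi a, ENNReal.ofReal t⁻¹ *
          {x | t < W x ^ p}.indicator (fun x => ENNReal.ofReal (W x ^ p)) x := by
        refine lintegral_mono fun x => ?_
        refine (mul_le_mul_right (ofReal_log_div_le_setLIntegral ha
          (rpow_pos_of_pos (hW0 x) p)) _).trans_eq ?_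
        rw [← lintegral_const_mul' _ _ ENNReal.ofReal_ne_top]
        refine lintegral_congr fun t => ?_
        simp only [Set.indicator, mem_ofPred_eq, mul_ite, mul_zero]
        rw [mul_comm]
    _ = ∫⁻ t in Ioi a, ∫⁻ x in icoCube c h, ENNReal.ofReal t⁻¹ *
          {x | t < W x ^ p}.indicator (fun x => ENNReal.ofReal (W x ^ p)) x := by
        refine lintegral_lintegral_swap (Measurable.aemeasurable ?_)
        refine (measurable_snd.inv.ennreal_ofReal).mul ?_
        exact Measurable.ite (measurableSet_lt measurable_snd (hWpm.comp measurable_fst))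
          (hWpm.comp measurable_fst).ennreal_ofReal measurable_const
    _ ≤ ∫⁻ t in Ioi a, ∫⁻ x in icoCube c h, ENNReal.ofReal (2 ^ n * (2 * C) * W x) *
          {t | t < (2 * C * W x) ^ p}.indicator (fun t => ENNReal.ofReal (t ^ (-(1 / p)))) t := by
        refine setLIntegral_mono' measurableSet_Ioi fun t ht => ?_
        have ht0 : 0 < t := ha.trans ht
        rw [lintegral_const_mul' _ _ ENNReal.ofReal_ne_top]
        refine (mul_le_mul_right (setLIntegral_rpow_superlevel_le hp hWm hW0 hWp hC0 hRH c hh ht0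
          (hQ.trans (mul_le_mul_left (ENNReal.ofReal_le_ofReal (le_of_lt ht)) _))) _).trans_eq ?_
        rw [← lintegral_const_mul' _ _ ENNReal.ofReal_ne_top]
        refine lintegral_congr fun x => ?_
        have hx := hW0 x
        simp only [Set.indicator, mem_ofPred_eq, mul_ite, mul_zero]
        congr 1
        rw [← ENNReal.ofReal_mul (by positivity), ← ENNReal.ofReal_mul (by positivity)]
        congr 1
        rw [sub_eq_add_neg, rpow_add ht0, rpow_one]
        field_simp
    _ = ∫⁻ x in icoCube c h, ∫⁻ t in Ioi a, ENNReal.ofReal (2 ^ n * (2 * C) * W x) *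
          {t | t < (2 * C * W x) ^ p}.indicator (fun t => ENNReal.ofReal (t ^ (-(1 / p)))) t := by
        refine lintegral_lintegral_swap (Measurable.aemeasurable ?_)
        refine ((hWm.comp measurable_snd).const_mul _).ennreal_ofReal.mul ?_
        exact Measurable.ite (measurableSet_lt measurable_fst
          (((hWm.comp measurable_snd).const_mul _).pow_const p))
          (measurable_fst.pow_const _).ennreal_ofReal measurable_const
    _ ≤ ∫⁻ x in icoCube c h, ENNReal.ofReal (2 ^ n * (2 * C) ^ p * (p / (p - 1))) *
          ENNReal.ofReal (W x ^ p) := by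
        refine lintegral_mono fun x => ?_
        have hx := hW0 x
        have hp1 : 0 < p - 1 := sub_pos.2 hp
        have hb : 0 < 2 * C * W x := by positivity
        simp only
        rw [lintegral_const_mul' _ _ ENNReal.ofReal_ne_top]
        refine (mul_le_mul_right (setLIntegral_rpow_neg_le hp ha hb) _).trans_eq ?_
        rw [← ENNReal.ofReal_mul (by positivity), ← ENNReal.ofReal_mul (by positivity)]
        congr 1
        have e : (2 * C * W x) ^ p = (2 * C * W x) ^ (p - 1) * (2 * C * W x) := by
          rw [← rpow_add_one hb.ne', sub_add_cancel]
        have e' : (2 * C * W x) ^ p = (2 * C) ^ p * W x ^ p := mul_rpow (by positivity) hx.le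
        calc _ = 2 ^ n * ((2 * C * W x) ^ (p - 1) * (2 * C * W x)) * (p / (p - 1)) := by ring
          _ = _ := by rw [← e, e']; ring
    _ = _ := lintegral_const_mul' _ _ ENNReal.ofReal_ne_top

lemma cubeAvg_congr_ae {f g : (Fin n → ℝ) → ℝ} (hfg : f =ᵐ[volume] g) (c : Fin n → ℝ) (h : ℝ) :
    cubeAvg f c h = cubeAvg g c h := by
  rw [cubeAvg, cubeAvg, integral_congr_ae (ae_restrict_of_ae hfg)]

lemma cubeAvg_pos {f : (Fin n → ℝ) → ℝ} (hf : LocallyIntegrable f) (hf0 : ∀ x, 0 < f x)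
    (c : Fin n → ℝ) {h : ℝ} (hh : 0 < h) : 0 < cubeAvg f c h := by
  rw [cubeAvg_eq_setAverage, setAverage_eq, smul_eq_mul]
  have hv := ENNReal.toReal_pos (volume_icoCube_ne_zero c hh) (volume_icoCube_ne_top c h)
  refine mul_pos (inv_pos.2 hv) ?_
  rw [setIntegral_pos_iff_support_of_nonneg_ae (ae_of_all _ fun x => (hf0 x).le)
    (integrableOn_icoCube hf c h)]
  have : Function.support f = univ := eq_univ_of_forall fun x => (hf0 x).ne'
  rw [this, univ_inter]
  exact pos_iff_ne_zero.2 (volume_icoCube_ne_zero c hh)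

lemma cubeAvg_le_cubeAvg_rpow {p : ℝ} (hp : 1 < p) {W : (Fin n → ℝ) → ℝ}
    (hW : LocallyIntegrable W) (hW0 : ∀ x, 0 < W x) (hWp : LocallyIntegrable fun x => W x ^ p)
    (c : Fin n → ℝ) {h : ℝ} (hh : 0 < h) :
    cubeAvg W c h ≤ cubeAvg (fun x => W x ^ p) c h ^ (1 / p) := by
  have hp0 : 0 < p := one_pos.trans hp
  rw [one_div, le_rpow_inv_iff_of_pos (cubeAvg_pos hW hW0 c hh).le
    (cubeAvg_pos hWp (fun x => rpow_pos_of_pos (hW0 x) p) c hh).le hp0,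
    cubeAvg_eq_setAverage, cubeAvg_eq_setAverage]
  exact (convexOn_rpow hp.le).map_set_average_le
    (continuousOn_id.rpow_const fun _ _ => Or.inr hp0.le) isClosed_Ici
    (volume_icoCube_ne_zero c hh) (volume_icoCube_ne_top c h)
    (ae_of_all _ fun x => (hW0 x).le) (integrableOn_icoCube hW c h)
    (integrableOn_icoCube hWp c h)

lemma log_exp_one_add_le {y : ℝ} (hy : 0 < y) :
    Real.log (Real.exp 1 + y) ≤ 2 + max (Real.log y) 0 := by
  have he : (2 : ℝ) ≤ Real.exp 1 := by linarith [Real.add_one_le_exp (1 : ℝ)]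
  have he2 : Real.exp 2 = Real.exp 1 * Real.exp 1 := by rw [← Real.exp_add]; norm_num
  rcases le_total y 1 with h1 | h1
  · refine le_trans ?_ (le_add_of_nonneg_right (le_max_right _ _))
    rw [Real.log_le_iff_le_exp (by positivity), he2]
    nlinarith
  · refine le_trans ?_ (add_le_add_right (le_max_left _ _) _)
    rw [Real.log_le_iff_le_exp (by positivity), Real.exp_add, Real.exp_log hy, he2]
    have h2 : Real.exp 1 + 1 ≤ Real.exp 1 * Real.exp 1 := by nlinarith
    nlinarith [mul_nonneg (by linarith : 0 ≤ Real.exp 1 * Real.exp 1 - 1) (sub_nonneg.2 h1)]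

lemma ofReal_mul_log_exp_one_add_le {y : ℝ} (hy : 0 < y) :
    ENNReal.ofReal (y * Real.log (Real.exp 1 + y)) ≤
      ENNReal.ofReal 2 * ENNReal.ofReal y + ENNReal.ofReal y * ENNReal.ofReal (Real.log y) := by
  rw [ENNReal.ofReal_mul hy.le, mul_comm (ENNReal.ofReal 2), ← mul_add]
  gcongr
  refine (ENNReal.ofReal_le_ofReal (log_exp_one_add_le hy)).trans ?_
  rw [ENNReal.ofReal_add two_pos.le (le_max_right _ _), ENNReal.ofReal_max]
  simp

/-- The `L log L` estimate for `W ^ p`, for a measurable and everywhere positive weight. -/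
lemma setLIntegral_mul_log_exp_one_add_le {p : ℝ} (hp : 1 < p) {W : (Fin n → ℝ) → ℝ}
    (hWm : Measurable W) (hW : LocallyIntegrable W) (hW0 : ∀ x, 0 < W x)
    (hWp : LocallyIntegrable fun x => W x ^ p) {C : ℝ} (hC0 : 0 < C)
    (hC : ∀ (c : Fin n → ℝ) (h : ℝ), 0 < h →
      cubeAvg (fun x => W x ^ p) c h ^ (1 / p) ≤ C * cubeAvg W c h)
    (c : Fin n → ℝ) {h : ℝ} (hh : 0 < h) :
    ∫⁻ x in icoCube c h, ENNReal.ofReal ((W x ^ p / cubeAvg (fun y => W y ^ p) c h) *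
        Real.log (Real.exp 1 + W x ^ p / cubeAvg (fun y => W y ^ p) c h)) ≤
      ENNReal.ofReal (2 + 2 ^ n * (2 * C) ^ p * (p / (p - 1))) * volume (icoCube c h) := by
  have hp0 : 0 < p := one_pos.trans hp
  have hp1 : 0 < p - 1 := sub_pos.2 hp
  have hWp0 : ∀ x, 0 < W x ^ p := fun x => rpow_pos_of_pos (hW0 x) p
  have hmass := ofReal_cubeAvg_mul_volume hWp (fun x => (hWp0 x).le) c h
  have ha := cubeAvg_pos hWp hWp0 c hh
  set a := cubeAvg (fun x => W x ^ p) c h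
  have hRH : ∀ (c : Fin n → ℝ) (h t : ℝ), 0 < h → 0 < t →
      ENNReal.ofReal t * volume (icoCube c h) < ∫⁻ x in icoCube c h, ENNReal.ofReal (W x ^ p) →
      ENNReal.ofReal (t ^ (1 / p) / C) * volume (icoCube c h) ≤
        ∫⁻ x in icoCube c h, ENNReal.ofReal (W x) := by
    intro c h t hh ht hlt
    rw [← ofReal_cubeAvg_mul_volume hWp (fun x => (hWp0 x).le) c h] at hlt
    rw [← ofReal_cubeAvg_mul_volume hW (fun x => (hW0 x).le) c h]
    have hlt' := (ENNReal.ofReal_lt_ofReal_iff (cubeAvg_pos hWp hWp0 c hh)).1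
      (lt_of_mul_lt_mul_right' hlt)
    gcongr
    rw [div_le_iff₀' hC0]
    exact (rpow_le_rpow ht.le hlt'.le (by positivity)).trans (hC c h hh)
  have hlog := setLIntegral_rpow_mul_log_le hp hWm hW0 hWp hC0 hRH c hh ha hmass.ge
  have hWpm : Measurable fun x => ENNReal.ofReal (W x ^ p) := (hWm.pow_const p).ennreal_ofReal
  calc ∫⁻ x in icoCube c h, ENNReal.ofReal ((W x ^ p / a) *
          Real.log (Real.exp 1 + W x ^ p / a))
      ≤ ∫⁻ x in icoCube c h, ENNReal.ofReal a⁻¹ * (ENNReal.ofReal 2 * ENNReal.ofReal (W x ^ p) +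
          ENNReal.ofReal (W x ^ p) * ENNReal.ofReal (Real.log (W x ^ p / a))) := by
        refine lintegral_mono fun x => ?_
        refine (ofReal_mul_log_exp_one_add_le (div_pos (hWp0 x) ha)).trans_eq ?_
        rw [div_eq_inv_mul, ENNReal.ofReal_mul (inv_pos.2 ha).le]
        ring
    _ = ENNReal.ofReal a⁻¹ * (ENNReal.ofReal 2 * (∫⁻ x in icoCube c h, ENNReal.ofReal (W x ^ p)) +
          ∫⁻ x in icoCube c h, ENNReal.ofReal (W x ^ p) *
            ENNReal.ofReal (Real.log (W x ^ p / a))) := by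
        rw [lintegral_const_mul' _ _ ENNReal.ofReal_ne_top, lintegral_add_left (hWpm.const_mul _),
          lintegral_const_mul' _ _ ENNReal.ofReal_ne_top]
    _ ≤ ENNReal.ofReal a⁻¹ * (ENNReal.ofReal 2 * (∫⁻ x in icoCube c h, ENNReal.ofReal (W x ^ p)) +
          ENNReal.ofReal (2 ^ n * (2 * C) ^ p * (p / (p - 1))) *
            ∫⁻ x in icoCube c h, ENNReal.ofReal (W x ^ p)) := by gcongr
    _ = _ := by
        rw [← add_mul, ← ENNReal.ofReal_add two_pos.le (by positivity), ← hmass,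
          mul_left_comm, ← mul_assoc (ENNReal.ofReal a⁻¹), ← ENNReal.ofReal_mul (inv_pos.2 ha).le,
          inv_mul_cancel₀ ha.ne', ENNReal.ofReal_one, one_mul]

lemma exists_measurable_pos_ae_eq {w : (Fin n → ℝ) → ℝ} (hw : LocallyIntegrable w)
    (hpos : ∀ᵐ x ∂volume, 0 < w x) :
    ∃ W : (Fin n → ℝ) → ℝ, Measurable W ∧ (∀ x, 0 < W x) ∧ w =ᵐ[volume] W := by
  have hm := hw.aestronglyMeasurable.aemeasurable
  refine ⟨fun x => if 0 < hm.mk w x then hm.mk w x else 1, ?_, fun x => ?_, ?_⟩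
  · exact Measurable.ite (measurableSet_lt measurable_const hm.measurable_mk) hm.measurable_mk
      measurable_const
  · simp only
    split_ifs with h
    exacts [h, one_pos]
  · filter_upwards [hm.ae_eq_mk, hpos] with x hx h0
    rw [if_pos (hx ▸ h0), hx]

end Cubes

lemma two_add_le_six_pow_mul {n : ℕ} (hn : 0 < n) {p C : ℝ} (hp : 1 < p) (hC : 1 ≤ C) :
    2 + (2 : ℝ) ^ n * (2 * C) ^ p * (p / (p - 1)) ≤
      (6 : ℝ) ^ n * (2 : ℝ) ^ p * (p / (p - 1)) * C ^ p := by
  have hp0 : 0 < p := one_pos.trans hp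
  have h1 : (1 : ℝ) ≤ p / (p - 1) := (one_le_div (sub_pos.2 hp)).2 (by linarith)
  have h2 : (1 : ℝ) ≤ 2 ^ p := one_le_rpow one_le_two hp0.le
  have h3 : (1 : ℝ) ≤ C ^ p := one_le_rpow hC hp0.le
  have hX : (1 : ℝ) ≤ 2 ^ p * (p / (p - 1)) * C ^ p :=
    one_le_mul_of_one_le_of_one_le (one_le_mul_of_one_le_of_one_le h2 h1) h3
  have h6 : (2 : ℝ) + 2 ^ n ≤ 6 ^ n := by
    have e : (6 : ℝ) ^ n = 3 ^ n * 2 ^ n := by rw [← mul_pow]; norm_num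
    have h2n : (2 : ℝ) ≤ 2 ^ n := le_self_pow₀ one_le_two hn.ne'
    have h3n : (3 : ℝ) ≤ 3 ^ n := le_self_pow₀ (by norm_num) hn.ne'
    rw [e]
    nlinarith
  rw [mul_rpow two_pos.le (by linarith)]
  nlinarith

/-- **1-Gehring implies p-Gehring (reduction step).**
Let `1 < p < ∞` and let `w` be a weight on `ℝⁿ` whose Reverse Hölder constant
`[w]_{RH_p}` (over axis-parallel cubes) is bounded by `C`. Then for every
axis-parallel cube `I`,
`⟨(wᵖ/⟨wᵖ⟩_I)·log(e + wᵖ/⟨wᵖ⟩_I)⟩_I ≤ 6ⁿ·2ᵖ·(p/(p−1))·Cᵖ`;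
that is, `wᵖ` belongs to `RH₁` with the stated bound on its `RH₁` constant. -/
theorem one_gehring_implies_p_gehring
    (n : ℕ) (hn : 0 < n) (p : ℝ) (hp : 1 < p)
    (w : (Fin n → ℝ) → ℝ) (hw : LocallyIntegrable w)
    (hpos : ∀ᵐ x ∂volume, 0 < w x)
    (hwp : LocallyIntegrable (fun x => w x ^ p))
    (C : ℝ)
    (hC : ∀ (c : Fin n → ℝ) (h : ℝ), 0 < h →
      (cubeAvg (fun x => w x ^ p) c h) ^ (1/p) ≤ C * cubeAvg w c h) :
    ∀ (c : Fin n → ℝ) (h : ℝ), 0 < h →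
      IntegrableOn (fun x => (w x ^ p / cubeAvg (fun y => w y ^ p) c h) *
        Real.log (Real.exp 1 + w x ^ p / cubeAvg (fun y => w y ^ p) c h)) (cube c h) ∧
      cubeAvg (fun x => (w x ^ p / cubeAvg (fun y => w y ^ p) c h) *
          Real.log (Real.exp 1 + w x ^ p / cubeAvg (fun y => w y ^ p) c h)) c h ≤
        (6:ℝ)^n * (2:ℝ)^p * (p/(p-1)) * C^p := by
  intro c h hh
  obtain ⟨W, hWm, hW0, hwW⟩ := exists_measurable_pos_ae_eq hw hpos
  have hwpW : (fun x => w x ^ p) =ᵐ[volume] fun x => W x ^ p :=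
    hwW.mono fun x hx => by simp only [hx]
  have hW : LocallyIntegrable W := hw.congr hwW
  have hWp : LocallyIntegrable fun x => W x ^ p := hwp.congr hwpW
  have hCW : ∀ (c : Fin n → ℝ) (h : ℝ), 0 < h →
      cubeAvg (fun x => W x ^ p) c h ^ (1 / p) ≤ C * cubeAvg W c h := fun c h hh => by
    rw [← cubeAvg_congr_ae hwW, ← cubeAvg_congr_ae hwpW]
    exact hC c h hh
  have hC1 : 1 ≤ C := by
    have h1 := (cubeAvg_le_cubeAvg_rpow hp hW hW0 hWp c hh).trans (hCW c h hh)
    exact (le_mul_iff_one_le_left (cubeAvg_pos hW hW0 c hh)).1 h1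
  have hC0 : 0 < C := one_pos.trans_le hC1
  have hmain := setLIntegral_mul_log_exp_one_add_le hp hWm hW hW0 hWp hC0 hCW c hh
  rw [cubeAvg_congr_ae hwpW c h]
  have ha := cubeAvg_pos hWp (fun x => rpow_pos_of_pos (hW0 x) p) c hh
  set a := cubeAvg (fun y => W y ^ p) c h
  set Φ : (Fin n → ℝ) → ℝ := fun x => (W x ^ p / a) * Real.log (Real.exp 1 + W x ^ p / a)
  have hΦ : (fun x => (w x ^ p / a) * Real.log (Real.exp 1 + w x ^ p / a)) =ᵐ[volume] Φ :=
    hwW.mono fun x hx => by simp only [hx, Φ]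
  have hy : ∀ x, 0 < W x ^ p / a := fun x => div_pos (rpow_pos_of_pos (hW0 x) p) ha
  have hΦ0 : ∀ x, 0 ≤ Φ x := fun x => mul_nonneg (hy x).le
    (Real.log_nonneg (by linarith [Real.add_one_le_exp (1 : ℝ), hy x]))
  have hΦm : Measurable Φ := ((hWm.pow_const p).div_const a).mul
    (((hWm.pow_const p).div_const a).const_add _).log
  have hfin := ENNReal.mul_ne_top (ENNReal.ofReal_ne_top
    (r := 2 + 2 ^ n * (2 * C) ^ p * (p / (p - 1)))) (volume_icoCube_ne_top c h)
  have hΦi : IntegrableOn Φ (icoCube c h) :=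
    ⟨hΦm.aestronglyMeasurable, (hasFiniteIntegral_iff_ofReal (ae_of_all _ hΦ0)).2
      (hmain.trans_lt hfin.lt_top)⟩
  constructor
  · rw [← integrableOn_congr_set_ae (icoCube_ae_eq_cube c h)]
    exact hΦi.congr (ae_restrict_of_ae hΦ.symm)
  · refine le_trans ?_ (two_add_le_six_pow_mul hn hp hC1)
    rw [cubeAvg_congr_ae hΦ, cubeAvg_eq_setAverage, setAverage_eq, smul_eq_mul, measureReal_def,
      inv_mul_le_iff₀
      (ENNReal.toReal_pos (volume_icoCube_ne_zero c hh) (volume_icoCube_ne_top c h)),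
      integral_eq_lintegral_of_nonneg_ae (ae_of_all _ hΦ0) hΦm.aestronglyMeasurable]
    refine (ENNReal.toReal_mono hfin hmain).trans_eq ?_
    have hp1 : 0 < p - 1 := sub_pos.2 hp
    rw [ENNReal.toReal_mul, ENNReal.toReal_ofReal (by positivity), mul_comm]
end

section
/- Let w be a weight on ℝ such that w·log w is locally integrable, and for n ≥ 1 define the truncation w_n(t) = 1/n if w(t) ≤ 1/n, w_n(t) = w(t) if 1/n ≤ w(t) ≤ n, and w_n(t) = n if w(t) ≥ n. Then [w_n]_{RH_1} ≤ [w]_{RH_1}. -/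
open MeasureTheory Real

/-- The average `⟨f⟩_{(a,b)} = (b-a)⁻¹ ∫_a^b f` of a function over a bounded interval. -/
noncomputable def intAvg (f : ℝ → ℝ) (a b : ℝ) : ℝ := (b - a)⁻¹ * ∫ t in a..b, f t

/-- For a truncation to `[l, u]`, the sign of `x - c * max l (min x u)` changes at most once, so it
correlates with the logarithm of the truncation. -/
lemma exists_forall_truncation_log_sub_mul_nonneg {l u c : ℝ} (hl : 0 < l) (hlu : l ≤ u) :
    ∃ m : ℝ, ∀ x : ℝ, 0 ≤ (log (max l (min x u)) - m) * (x - c * max l (min x u)) := by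
  rcases le_total 1 c with h1 | h1
  · refine ⟨log u, fun x => ?_⟩
    have hy : 0 < max l (min x u) := lt_max_of_lt_left hl
    have hyu : max l (min x u) ≤ u := max_le hlu (min_le_right _ _)
    rcases le_total u x with hx | hx
    · simp [min_eq_right hx, max_eq_right hlu]
    · refine mul_nonneg_of_nonpos_of_nonpos (sub_nonpos.2 (log_le_log hy hyu)) ?_
      have hxy : x ≤ max l (min x u) := by simp [min_eq_left hx]
      nlinarith
  · refine ⟨log l, fun x => ?_⟩
    have hy : 0 < max l (min x u) := lt_max_of_lt_left hl
    rcases le_total x l with hx | hx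
    · simp [min_eq_left (hx.trans hlu), max_eq_left hx]
    · refine mul_nonneg (sub_nonneg.2 (log_le_log hl (le_max_left _ _))) ?_
      have hxy : max l (min x u) ≤ x := max_le hx (min_le_left _ _)
      nlinarith

/-- The tangent line inequality for `x * log x`. -/
lemma mul_log_add_sub_le_mul_log {x y : ℝ} (hx : 0 < x) (hy : 0 < y) :
    x * log y + (x - y) ≤ x * log x := by
  have h := mul_le_mul_of_nonneg_left (log_le_sub_one_of_pos (div_pos hy hx)) hx.le
  rw [log_div hy.ne' hx.ne', mul_sub, mul_sub, mul_div_cancel₀ _ hx.ne'] at h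
  linarith

lemma integrable_truncation {α : Type*} [MeasurableSpace α] {μ : Measure α} [IsFiniteMeasure μ]
    {f : α → ℝ} (hf : Integrable f μ) (l u : ℝ) :
    Integrable (fun t => max l (min (f t) u)) μ :=
  (integrable_const l).sup (hf.inf (integrable_const u))

lemma integrable_truncation_mul_log {α : Type*} [MeasurableSpace α] {μ : Measure α}
    [IsFiniteMeasure μ] {f : α → ℝ} (hf : Integrable f μ) {l u : ℝ} (hlu : l ≤ u) :
    Integrable (fun t => max l (min (f t) u) * log (max l (min (f t) u))) μ := by
  obtain ⟨C, hC⟩ := (isCompact_Icc (a := l) (b := u)).exists_bound_of_continuousOn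
    continuous_mul_log.continuousOn
  refine Integrable.of_bound
    (continuous_mul_log.comp_aestronglyMeasurable (integrable_truncation hf l u).1) C ?_
  exact .of_forall fun t => hC _ ⟨le_max_left _ _, max_le hlu (min_le_right _ _)⟩

/-- Truncation does not increase the entropy of the normalized density. -/
lemma integral_truncation_mul_log_le {α : Type*} [MeasurableSpace α] {μ : Measure α}
    [IsFiniteMeasure μ] {f : α → ℝ} {l u : ℝ} (hl : 0 < l) (hlu : l ≤ u)
    (hf : Integrable f μ) (hpos : ∀ᵐ t ∂μ, 0 < f t)
    (hflog : Integrable (fun t => f t * log (f t)) μ)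
    (hA : 0 < ∫ t, f t ∂μ) (hB : 0 < ∫ t, max l (min (f t) u) ∂μ) :
    (∫ t, f t ∂μ) / (∫ t, max l (min (f t) u) ∂μ) *
        (∫ t, max l (min (f t) u) * log (max l (min (f t) u)) ∂μ) +
      (∫ t, f t ∂μ) * log ((∫ t, f t ∂μ) / (∫ t, max l (min (f t) u) ∂μ)) ≤
    ∫ t, f t * log (f t) ∂μ := by
  have hg := integrable_truncation hf l u
  have hglog := integrable_truncation_mul_log hf hlu
  set A := ∫ t, f t ∂μ with hAdef
  set B := ∫ t, max l (min (f t) u) ∂μ with hBdef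
  have hc : 0 < A / B := div_pos hA hB
  obtain ⟨m, hm⟩ := exists_forall_truncation_log_sub_mul_nonneg hl hlu (c := A / B)
  set c := A / B with hcdef
  have hint := ((hglog.const_mul c).add (hf.const_mul (log c))).add
    ((hf.sub (hg.const_mul c)).const_mul (m + 1))
  have key := integral_mono_ae hint hflog (by
    filter_upwards [hpos] with t ht
    have hy : 0 < max l (min (f t) u) := lt_max_of_lt_left hl
    have h1 := mul_log_add_sub_le_mul_log ht (mul_pos hc hy)
    rw [log_mul hc.ne' hy.ne'] at h1
    have h2 := hm (f t)
    simp only [Pi.add_apply, Pi.sub_apply]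
    linarith)
  rw [integral_add' ((hglog.const_mul c).add (hf.const_mul (log c)))
      ((hf.sub (hg.const_mul c)).const_mul (m + 1)),
    integral_add' (hglog.const_mul c) (hf.const_mul (log c)), integral_const_mul,
    integral_const_mul, integral_const_mul, integral_sub' hf (hg.const_mul c),
    integral_const_mul, ← hAdef, ← hBdef, hcdef, div_mul_cancel₀ _ hB.ne'] at key
  linarith

/-- **Truncation does not increase the `RH₁` constant.**
Let `w` be a weight with `w·log w` locally integrable and let `wn` be its truncation at
levels `1/n` and `n` (for `n ≥ 1`). If `Q` bounds the `RH₁` constant of `w` (interval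
wise), then `Q` also bounds the `RH₁` constant of `wn`; i.e. `[wₙ]_{RH₁} ≤ [w]_{RH₁}`. -/
theorem truncation_rh1
    (w : ℝ → ℝ) (hw : LocallyIntegrable w)
    (hpos : ∀ᵐ t ∂volume, 0 < w t)
    (hwlog : LocallyIntegrable (fun t => w t * Real.log (w t)))
    (n : ℕ) (hn : 1 ≤ n)
    (wn : ℝ → ℝ) (hwn : ∀ t, wn t = max (1/(n:ℝ)) (min (w t) (n:ℝ)))
    (Q : ℝ)
    (hRH : ∀ a b : ℝ, a < b →
      intAvg (fun t => w t * Real.log (w t)) a b ≤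
        intAvg w a b * Real.log (intAvg w a b) + Q * intAvg w a b) :
    ∀ a b : ℝ, a < b →
      intAvg (fun t => wn t * Real.log (wn t)) a b ≤
        intAvg wn a b * Real.log (intAvg wn a b) + Q * intAvg wn a b := by
  intro a b hab
  obtain rfl : wn = fun t => max (1/(n:ℝ)) (min (w t) (n:ℝ)) := funext hwn
  have hn1 : (1 : ℝ) ≤ n := by exact_mod_cast hn
  have hl : 0 < 1 / (n : ℝ) := by positivity
  have hlu : 1 / (n : ℝ) ≤ n := ((div_le_one (by positivity)).2 hn1).trans hn1
  have hwI := (hw.integrableOn_isCompact (isCompact_Icc (a := a) (b := b))).mono_set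
    Set.Ioc_subset_Icc_self
  have hwlogI := (hwlog.integrableOn_isCompact (isCompact_Icc (a := a) (b := b))).mono_set
    Set.Ioc_subset_Icc_self
  have hvol : volume (Set.Ioc a b) ≠ 0 := by simp [hab]
  have integral_pos_of_pos {f : ℝ → ℝ} (hf : IntegrableOn f (Set.Ioc a b))
      (hf0 : ∀ᵐ t ∂volume, 0 < f t) : 0 < ∫ t in Set.Ioc a b, f t := by
    have h0 := ae_restrict_of_ae (s := Set.Ioc a b) hf0
    refine (integral_nonneg_of_ae (h0.mono fun t ht => ht.le)).lt_of_ne fun h => hvol ?_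
    rw [eq_comm, integral_eq_zero_iff_of_nonneg_ae (h0.mono fun t ht => ht.le) hf] at h
    have hF : ∀ᵐ t ∂volume.restrict (Set.Ioc a b), False := by
      filter_upwards [h0, h] with t h1 h2
      exact h1.ne' h2
    exact Measure.restrict_eq_zero.1
      (ae_eq_bot.1 (Filter.eventually_false_iff_eq_bot.1 hF))
  have hA := integral_pos_of_pos hwI hpos
  have hB := integral_pos_of_pos (integrable_truncation hwI (1 / (n : ℝ)) n)
    (.of_forall fun t => lt_max_of_lt_left hl)
  have key := integral_truncation_mul_log_le hl hlu hwI (ae_restrict_of_ae hpos) hwlogI hA hB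
  have hQ := hRH a b hab
  have hd : 0 < (b - a)⁻¹ := inv_pos.2 (sub_pos.2 hab)
  simp only [intAvg, intervalIntegral.integral_of_le hab.le] at hQ ⊢
  generalize (∫ t in Set.Ioc a b, w t) = A at *
  generalize (∫ t in Set.Ioc a b, max (1 / (n : ℝ)) (min (w t) n)) = B at *
  generalize (∫ t in Set.Ioc a b, w t * log (w t)) = S at *
  generalize (∫ t in Set.Ioc a b, max (1 / (n : ℝ)) (min (w t) n) *
    log (max (1 / (n : ℝ)) (min (w t) n))) = T at *
  generalize (b - a)⁻¹ = d at *
  rw [log_div hA.ne' hB.ne'] at key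
  rw [log_mul hd.ne' hA.ne'] at hQ
  rw [log_mul hd.ne' hB.ne']
  have h := (mul_le_mul_of_nonneg_left key hd.le).trans hQ
  refine le_of_mul_le_mul_left ?_ (div_pos hA hB)
  have hAB : A / B * B = A := div_mul_cancel₀ _ hB.ne'
  calc A / B * (d * T) ≤ A * (d * (log d + log B) + Q * d) := by linarith
    _ = A / B * B * (d * (log d + log B) + Q * d) := by rw [hAB]
    _ = _ := by ring
end

section
/- Let w be a weight on ℝ such that log w is locally integrable, and for n ≥ 1 define the truncation w_n(t) = 1/n if w(t) ≤ 1/n, w_n(t) = w(t) if 1/n ≤ w(t) ≤ n, and w_n(t) = n if w(t) ≥ n. Then [w_n]_{A_∞} ≤ [w]_{A_∞}. -/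
open MeasureTheory Real

/-- The ratio `x / v` of a number to its truncation `v` is comonotone with `v`. -/
lemma div_truncation_mul_le {x c d m : ℝ} (hc : 0 < c) (hcd : c ≤ d)
    (hm : m ∈ Set.Icc c d) :
    x / max c (min x d) * m ≤ x - max c (min x d) + m := by
  obtain ⟨hcm, hmd⟩ := hm
  have hd : 0 < d := hc.trans_le hcd
  rcases le_total x c with h | h
  · rw [min_eq_left (h.trans hcd), max_eq_left h, div_mul_eq_mul_div, div_le_iff₀ hc]
    nlinarith [mul_nonneg (sub_nonneg.2 h) (sub_nonneg.2 hcm)]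
  · rcases le_total x d with h' | h'
    · rw [min_eq_left h', max_eq_right h, div_self (hc.trans_le h).ne']
      linarith
    · rw [min_eq_right h', max_eq_right hcd, div_mul_eq_mul_div, div_le_iff₀ hd]
      nlinarith [mul_nonneg (sub_nonneg.2 h') (sub_nonneg.2 hmd)]

lemma log_sub_log_truncation_le {x c d m A : ℝ} (hx : 0 < x) (hc : 0 < c) (hcd : c ≤ d)
    (hm : m ∈ Set.Icc c d) (hA : 0 < A) :
    log x - log (max c (min x d)) ≤ (x - max c (min x d) + m) / A - 1 + log (A / m) := by
  have hm0 : 0 < m := hc.trans_le hm.1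
  have hv : 0 < max c (min x d) := lt_max_of_lt_left hc
  have h₁ := log_le_sub_one_of_pos (show 0 < x / max c (min x d) * m / A by positivity)
  rw [log_div (by positivity) hA.ne', log_mul (by positivity) hm0.ne',
    log_div hx.ne' hv.ne'] at h₁
  have h₂ := div_le_div_of_nonneg_right (div_truncation_mul_le (x := x) hc hcd hm) hA.le
  rw [log_div hA.ne' hm0.ne']
  linarith

lemma log_truncation {x c d : ℝ} (hx : 0 < x) (hc : 0 < c) (hd : 0 < d) :
    log (max c (min x d)) = max (log c) (min (log x) (log d)) := by
  rw [strictMonoOn_log.monotoneOn.map_max hc (lt_min hx hd),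
    strictMonoOn_log.monotoneOn.map_min hx hd]

lemma intAvg_eq_average {a b : ℝ} (hab : a < b) (f : ℝ → ℝ) :
    intAvg f a b = ⨍ t in Set.Ioc a b, f t := by
  rw [intAvg, setAverage_eq, intervalIntegral.integral_of_le hab.le, smul_eq_mul,
    measureReal_def, Real.volume_Ioc, ENNReal.toReal_ofReal (by linarith)]

/-- On a probability space, truncation does not increase the ratio of the arithmetic to the
geometric mean. -/
lemma integral_truncation_mul_exp_le {α : Type*} [MeasurableSpace α] {μ : Measure α}
    [IsProbabilityMeasure μ] {w : α → ℝ} {c d : ℝ} (hc : 0 < c) (hcd : c ≤ d)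
    (hw : Integrable w μ) (hpos : ∀ᵐ t ∂μ, 0 < w t)
    (hlog : Integrable (fun t => log (w t)) μ) :
    (∫ t, max c (min (w t) d) ∂μ) * exp (-∫ t, log (max c (min (w t) d)) ∂μ) ≤
      (∫ t, w t ∂μ) * exp (-∫ t, log (w t) ∂μ) := by
  have hd : 0 < d := hc.trans_le hcd
  have hv : Integrable (fun t => max c (min (w t) d)) μ :=
    (integrable_const c).sup (hw.inf (integrable_const d))
  have hlv : Integrable (fun t => log (max c (min (w t) d))) μ := by
    refine ((integrable_const (log c)).sup (hlog.inf (integrable_const (log d)))).congr ?_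
    filter_upwards [hpos] with t ht
    exact (log_truncation ht hc hd).symm
  set m := ∫ t, max c (min (w t) d) ∂μ with hm_def
  set A := ∫ t, w t ∂μ with hA_def
  have hm : m ∈ Set.Icc c d := by
    constructor
    · simpa using integral_mono (μ := μ) (integrable_const c) hv fun t => le_max_left _ _
    · simpa using integral_mono (μ := μ) hv (integrable_const d)
        fun t => max_le hcd (min_le_right _ _)
  have hm0 : 0 < m := hc.trans_le hm.1
  have hA : 0 < A := by
    rw [hA_def, integral_pos_iff_support_of_nonneg_ae (hpos.mono fun t ht => ht.le) hw]
    have : Function.support w =ᵐ[μ] Set.univ :=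
      Filter.eventuallyEq_univ.2 (hpos.mono fun t ht => ht.ne')
    rw [measure_congr this]
    simp
  have key : ∫ t, log (w t) ∂μ - ∫ t, log (max c (min (w t) d)) ∂μ ≤ log (A / m) := by
    have hi₁ : Integrable (fun t => w t - max c (min (w t) d)) μ := hw.sub hv
    have hi₂ : Integrable (fun t => w t - max c (min (w t) d) + m) μ :=
      hi₁.add (integrable_const m)
    have hi₃ : Integrable (fun t => (w t - max c (min (w t) d) + m) / A - 1) μ :=
      (hi₂.div_const A).sub (integrable_const 1)
    have h := integral_mono_ae (hlog.sub hlv) (hi₃.add (integrable_const (log (A / m))))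
      (hpos.mono fun t ht => log_sub_log_truncation_le ht hc hcd hm hA)
    simp only [Pi.sub_apply, Pi.add_apply] at h
    rw [integral_sub hlog hlv, integral_add hi₃ (integrable_const _),
      integral_sub (hi₂.div_const A) (integrable_const 1), integral_div,
      integral_add hi₁ (integrable_const m), integral_sub hw hv] at h
    simpa [← hm_def, ← hA_def, hA.ne'] using h
  rw [← log_le_log_iff (by positivity) (by positivity), log_mul hm0.ne' (exp_pos _).ne',
    log_mul hA.ne' (exp_pos _).ne', log_exp, log_exp]
  rw [log_div hA.ne' hm0.ne'] at key
  linarith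

/-- **Truncation does not increase the `A_∞` constant.**
Let `w` be a weight with `log w` locally integrable and let `wn` be its truncation at
levels `1/n` and `n` (for `n ≥ 1`). If `Q` bounds the `A_∞` constant of `w` (interval
wise), then `Q` also bounds the `A_∞` constant of `wn`; i.e. `[wₙ]_{A_∞} ≤ [w]_{A_∞}`. -/
theorem truncation_ainfty
    (w : ℝ → ℝ) (hw : LocallyIntegrable w)
    (hpos : ∀ᵐ t ∂volume, 0 < w t)
    (hlog : LocallyIntegrable (fun t => Real.log (w t)))
    (n : ℕ) (hn : 1 ≤ n)
    (wn : ℝ → ℝ) (hwn : ∀ t, wn t = max (1/(n:ℝ)) (min (w t) (n:ℝ)))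
    (Q : ℝ)
    (hAinf : ∀ a b : ℝ, a < b →
      intAvg w a b * Real.exp (-(intAvg (fun t => Real.log (w t)) a b)) ≤ Q) :
    ∀ a b : ℝ, a < b →
      intAvg wn a b * Real.exp (-(intAvg (fun t => Real.log (wn t)) a b)) ≤ Q := by
  intro a b hab
  refine le_trans ?_ (hAinf a b hab)
  obtain rfl : wn = fun t => max (1/(n:ℝ)) (min (w t) (n:ℝ)) := funext hwn
  have hn' : (1:ℝ) ≤ n := by exact_mod_cast hn
  have hcd : 1 / (n:ℝ) ≤ n := (div_le_one₀ (by linarith)).2 hn' |>.trans hn'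
  have : NeZero (volume.restrict (Set.Ioc a b)) := ⟨by simp [Measure.restrict_eq_zero, hab]⟩
  have loc {f : ℝ → ℝ} (hf : LocallyIntegrable f) : IntegrableOn f (Set.Ioc a b) :=
    (hf.integrableOn_isCompact isCompact_Icc).mono_set Set.Ioc_subset_Icc_self
  simp only [intAvg_eq_average hab]
  exact integral_truncation_mul_exp_le (by positivity) hcd (loc hw).to_average
    (Measure.ae_smul_measure (ae_restrict_of_ae hpos) _) (loc hlog).to_average
end

section
/- (Splitting lemma for A_∞.) Fix Q_1 > Q > 0 and let Ω_{Q_1} = {(x,y) ∈ ℝ² : x > 0 and 1 ≤ x·e^{−y} ≤ Q_1}. There exists α ∈ (0, 1/2], depending only on Q and Q_1, such that for every weight w on ℝ with log w locally integrable and [w]_{A_∞} < Q, and every bounded interval I of positive length, I can be split into two adjacent subintervals I⁻ and I⁺ with I = I⁻ ∪ I⁺, α ≤ |I⁻|/|I| ≤ 1 − α, such that the closed line segment joining x⁻ = (⟨w⟩_{I⁻}, ⟨log w⟩_{I⁻}) and x⁺ = (⟨w⟩_{I⁺}, ⟨log w⟩_{I⁺}) is contained in Ω_{Q_1}. -/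
open MeasureTheory Real

theorem intAvg_eq_weighted_add {f : ℝ → ℝ} (hf : LocallyIntegrable f) {a b c : ℝ}
    (hac : a < c) (hcb : c < b) :
    intAvg f a b =
      (c - a) / (b - a) * intAvg f a c + (1 - (c - a) / (b - a)) * intAvg f c b := by
  have hint : ∀ x y : ℝ, IntervalIntegrable f volume x y := fun x y =>
    (hf.integrableOn_isCompact isCompact_uIcc).intervalIntegrable
  have hab : b - a ≠ 0 := by linarith
  have hac' : c - a ≠ 0 := by linarith
  have hcb' : b - c ≠ 0 := by linarith
  unfold intAvg
  rw [← intervalIntegral.integral_add_adjacent_intervals (hint a c) (hint c b)]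
  field_simp
  ring

theorem continuousOn_intAvg_right {f : ℝ → ℝ} (hf : LocallyIntegrable f) (a : ℝ) :
    ContinuousOn (fun c => intAvg f a c) (Set.Ioi a) := by
  have hint : ∀ x y : ℝ, IntervalIntegrable f volume x y := fun x y =>
    (hf.integrableOn_isCompact isCompact_uIcc).intervalIntegrable
  unfold intAvg
  refine ContinuousOn.mul (ContinuousOn.inv₀ (by fun_prop) fun c hc => ?_)
    (intervalIntegral.continuous_primitive hint a).continuousOn
  exact (sub_pos.2 hc).ne'

theorem continuousOn_intAvg_left {f : ℝ → ℝ} (hf : LocallyIntegrable f) (b : ℝ) :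
    ContinuousOn (fun c => intAvg f c b) (Set.Iio b) := by
  have hint : ∀ x y : ℝ, IntervalIntegrable f volume x y := fun x y =>
    (hf.integrableOn_isCompact isCompact_uIcc).intervalIntegrable
  unfold intAvg
  simp_rw [fun c => intervalIntegral.integral_symm (μ := volume) (f := f) b c]
  refine ContinuousOn.mul (ContinuousOn.inv₀ (by fun_prop) fun c hc => ?_)
    (intervalIntegral.continuous_primitive hint b).neg.continuousOn
  exact (sub_pos.2 hc).ne'

/-- Jensen's inequality for the exponential function. -/
theorem exp_intAvg_log_le_intAvg {w : ℝ → ℝ} (hw : LocallyIntegrable w)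
    (hpos : ∀ᵐ t ∂volume, 0 < w t) (hlog : LocallyIntegrable fun t => log (w t))
    {a b : ℝ} (hab : a < b) :
    exp (intAvg (fun t => log (w t)) a b) ≤ intAvg w a b := by
  set y := intAvg (fun t => log (w t)) a b with hy
  have hba : 0 < b - a := sub_pos.2 hab
  have hint : (∫ t in a..b, log (w t)) = (b - a) * y := by
    rw [hy, intAvg]; field_simp
  have hL : IntervalIntegrable (fun t => log (w t)) volume a b :=
    (hlog.integrableOn_isCompact isCompact_uIcc).intervalIntegrable
  have hle : (∫ t in a..b, exp y * (log (w t) + (1 - y))) ≤ ∫ t in a..b, w t := by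
    refine intervalIntegral.integral_mono_ae hab.le
      ((hL.add intervalIntegrable_const).const_mul _)
      (hw.integrableOn_isCompact isCompact_uIcc).intervalIntegrable ?_
    filter_upwards [hpos] with t ht
    have h := add_one_le_exp (log (w t) - y)
    rw [exp_sub, exp_log ht, le_div_iff₀ (exp_pos y)] at h
    linarith
  rw [intervalIntegral.integral_const_mul,
    intervalIntegral.integral_add hL intervalIntegrable_const, hint,
    intervalIntegral.integral_const, smul_eq_mul] at hle
  rw [intAvg, inv_mul_eq_div, le_div_iff₀ hba]
  linarith

theorem sqrt_one_sub_div_le_abs {Q Q1 s : ℝ} (hQ1 : 0 < Q1) (hs : -1 < s)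
    (h : Q1 * (1 + s) * exp (-s) ≤ Q) : √(1 - Q / Q1) ≤ |s| := by
  refine Real.sqrt_le_iff.2 ⟨abs_nonneg s, ?_⟩
  have h1 : (1 + s) * (1 - s) ≤ (1 + s) * exp (-s) :=
    mul_le_mul_of_nonneg_left (one_sub_le_exp_neg s) (by linarith)
  have h2 : (1 + s) * exp (-s) ≤ Q / Q1 := by
    rw [le_div_iff₀ hQ1]; linarith
  rw [sq_abs]
  nlinarith

theorem abs_le_of_one_le_mul_exp_neg {Q1 s : ℝ} (hQ1 : 0 < Q1) (hs : -1 < s)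
    (h : 1 ≤ Q1 * (1 + s) * exp (-s)) : |s| ≤ 8 * Q1 + 1 := by
  refine abs_le.2 ⟨by linarith, ?_⟩
  by_contra! hlt
  rw [exp_neg, ← div_eq_mul_inv, le_div_iff₀ (exp_pos s), one_mul] at h
  have h2 : exp s = exp (s / 2) * exp (s / 2) := by rw [← exp_add]; ring_nf
  have h3 := add_one_le_exp (s / 2)
  have h4 : (s / 2 + 1) * (s / 2 + 1) ≤ exp (s / 2) * exp (s / 2) := by
    gcongr; linarith
  nlinarith [mul_lt_mul_of_pos_right hlt (show 0 < s by linarith)]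

/-- A parametrised line is tangent to the curve `x e^{-y} = Q₁` at an interior point where
`x e^{-y}` is maximal with value `Q₁`. -/
theorem eq_mul_of_isMaxOn_mul_exp_neg {x₀ y₀ d₁ d₂ θ : ℝ} (hθ : θ ∈ Set.Ioo (0 : ℝ) 1)
    (hmax : IsMaxOn (fun r => (x₀ + r * d₁) * exp (-(y₀ + r * d₂))) (Set.Icc 0 1) θ) :
    d₁ = (x₀ + θ * d₁) * d₂ := by
  have hderiv : HasDerivAt (fun r => (x₀ + r * d₁) * exp (-(y₀ + r * d₂)))
      ((1 * d₁) * exp (-(y₀ + θ * d₂)) +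
        (x₀ + θ * d₁) * (exp (-(y₀ + θ * d₂)) * -(1 * d₂))) θ :=
    (((hasDerivAt_id θ).mul_const d₁).const_add x₀).mul
      (((((hasDerivAt_id θ).mul_const d₂).const_add y₀).neg).exp)
  have h := (hmax.isLocalMax (Icc_mem_nhds hθ.1 hθ.2)).hasDerivAt_eq_zero hderiv
  have h' : (d₁ - (x₀ + θ * d₁) * d₂) * exp (-(y₀ + θ * d₂)) = 0 := by linarith
  linarith [(mul_eq_zero.1 h').resolve_right (exp_pos _).ne']

theorem mul_exp_neg_eq_of_tangent {x₀ y₀ d₁ d₂ θ : ℝ} (r : ℝ)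
    (htan : d₁ = (x₀ + θ * d₁) * d₂) :
    x₀ + r * d₁ = (x₀ + θ * d₁) * (1 + (r - θ) * d₂) ∧
    (x₀ + r * d₁) * exp (-(y₀ + r * d₂)) =
      (x₀ + θ * d₁) * exp (-(y₀ + θ * d₂)) * (1 + (r - θ) * d₂) * exp (-((r - θ) * d₂)) := by
  have hx : x₀ + r * d₁ = (x₀ + θ * d₁) * (1 + (r - θ) * d₂) := by
    linear_combination (r - θ) * htan
  refine ⟨hx, ?_⟩
  rw [hx, show -(y₀ + r * d₂) = -(y₀ + θ * d₂) + -((r - θ) * d₂) by ring, exp_add]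
  ring

/-- Along a continuous family of segments issuing from a point, the maximum of `x e^{-y}`
attains every intermediate value. -/
theorem exists_isMaxOn_mul_exp_neg_eq {Q1 x₀ y₀ : ℝ} {p₁ p₂ : ℝ → ℝ}
    (hp₁ : ContinuousOn p₁ (Set.Icc 0 (1 / 2))) (hp₂ : ContinuousOn p₂ (Set.Icc 0 (1 / 2)))
    (h₁ : p₁ 0 = x₀) (h₂ : p₂ 0 = y₀) (h₀ : x₀ * exp (-y₀) < Q1)
    (hexit : ∃ r ∈ Set.Icc (0 : ℝ) 1,
      Q1 < (x₀ + r * (p₁ (1 / 2) - x₀)) * exp (-(y₀ + r * (p₂ (1 / 2) - y₀)))) :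
    ∃ t ∈ Set.Icc (0 : ℝ) (1 / 2), ∃ θ ∈ Set.Icc (0 : ℝ) 1,
      (x₀ + θ * (p₁ t - x₀)) * exp (-(y₀ + θ * (p₂ t - y₀))) = Q1 ∧
      IsMaxOn (fun r => (x₀ + r * (p₁ t - x₀)) * exp (-(y₀ + r * (p₂ t - y₀))))
        (Set.Icc 0 1) θ := by
  have hhalf : (0 : ℝ) ≤ 1 / 2 := by norm_num
  set q₁ := Set.IccExtend hhalf ((Set.Icc (0 : ℝ) (1 / 2)).domRestrict p₁)
  set q₂ := Set.IccExtend hhalf ((Set.Icc (0 : ℝ) (1 / 2)).domRestrict p₂)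
  have hc₁ : Continuous q₁ := (continuousOn_iff_continuous_domRestrict.1 hp₁).Icc_extend'
  have hc₂ : Continuous q₂ := (continuousOn_iff_continuous_domRestrict.1 hp₂).Icc_extend'
  have e₁ : ∀ t ∈ Set.Icc (0 : ℝ) (1 / 2), q₁ t = p₁ t := fun t ht =>
    Set.IccExtend_of_mem hhalf _ ht
  have e₂ : ∀ t ∈ Set.Icc (0 : ℝ) (1 / 2), q₂ t = p₂ t := fun t ht =>
    Set.IccExtend_of_mem hhalf _ ht
  let f : ℝ → ℝ → ℝ := fun t r => (x₀ + r * (q₁ t - x₀)) * exp (-(y₀ + r * (q₂ t - y₀)))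
  have hf : Continuous ↿f := by
    change Continuous fun z : ℝ × ℝ =>
      (x₀ + z.2 * (q₁ z.1 - x₀)) * exp (-(y₀ + z.2 * (q₂ z.1 - y₀)))
    fun_prop
  have hft : ∀ t, Continuous (f t) := fun t => hf.comp (Continuous.prodMk_right t)
  have hM : Continuous fun t => sSup (f t '' Set.Icc 0 1) := isCompact_Icc.continuous_sSup hf
  have hexM : ∀ t, ∃ θ ∈ Set.Icc (0 : ℝ) 1, sSup (f t '' Set.Icc 0 1) = f t θ ∧
      ∀ r ∈ Set.Icc (0 : ℝ) 1, f t r ≤ f t θ := fun t =>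
    isCompact_Icc.exists_sSup_image_eq_and_ge (Set.nonempty_Icc.2 zero_le_one)
      (hft t).continuousOn
  have hzero : sSup (f 0 '' Set.Icc 0 1) ≤ Q1 := by
    obtain ⟨θ, -, hθ, -⟩ := hexM 0
    rw [hθ]
    simp only [f, e₁ 0 ⟨le_rfl, hhalf⟩, e₂ 0 ⟨le_rfl, hhalf⟩, h₁, h₂, sub_self, mul_zero,
      add_zero]
    exact h₀.le
  have hend : Q1 ≤ sSup (f (1 / 2) '' Set.Icc 0 1) := by
    obtain ⟨θ, -, hθ, hge⟩ := hexM (1 / 2)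
    obtain ⟨r, hr, hlt⟩ := hexit
    rw [hθ]
    refine le_trans ?_ (hge r hr)
    simp only [f, e₁ (1 / 2) ⟨hhalf, le_rfl⟩, e₂ (1 / 2) ⟨hhalf, le_rfl⟩]
    exact hlt.le
  obtain ⟨t, ht, htM⟩ := intermediate_value_Icc hhalf hM.continuousOn ⟨hzero, hend⟩
  obtain ⟨θ, hθ, hθM, hge⟩ := hexM t
  have hval : f t θ = Q1 := hθM.symm.trans htM
  simp only [f, e₁ t ht, e₂ t ht] at hval hge
  exact ⟨t, ht, θ, hθ, hval, fun r hr => hge r hr⟩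

/-- If `x₀ = t n(t) + (1 - t) p(t)` with `p` continuous and `p(0) = x₀`, and the segment from `x₀`
to `p(1/2)` exits the domain `x e^{-y} ≤ Q₁`, then for some `t` bounded below the whole line
through `n(t)` and `p(t)` satisfies `x e^{-y} ≤ Q₁`. -/
theorem exists_segment_mul_exp_neg_le {Q Q1 x₀ y₀ : ℝ} (hQ : 0 < Q) (hQQ1 : Q < Q1)
    {p₁ p₂ n₁ n₂ : ℝ → ℝ}
    (hp₁ : ContinuousOn p₁ (Set.Icc 0 (1 / 2))) (hp₂ : ContinuousOn p₂ (Set.Icc 0 (1 / 2)))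
    (h₁ : p₁ 0 = x₀) (h₂ : p₂ 0 = y₀)
    (hx₀ : 0 < x₀) (h₀ : x₀ * exp (-y₀) ≤ Q)
    (hp : ∀ t ∈ Set.Ioc (0 : ℝ) (1 / 2), p₁ t * exp (-p₂ t) ≤ Q)
    (hn : ∀ t ∈ Set.Ioc (0 : ℝ) (1 / 2), 0 < n₁ t ∧ 1 ≤ n₁ t * exp (-n₂ t))
    (hsp₁ : ∀ t ∈ Set.Ioc (0 : ℝ) (1 / 2), x₀ = t * n₁ t + (1 - t) * p₁ t)
    (hsp₂ : ∀ t ∈ Set.Ioc (0 : ℝ) (1 / 2), y₀ = t * n₂ t + (1 - t) * p₂ t)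
    (hexit : ∃ r ∈ Set.Icc (0 : ℝ) 1,
      Q1 < (x₀ + r * (p₁ (1 / 2) - x₀)) * exp (-(y₀ + r * (p₂ (1 / 2) - y₀)))) :
    ∃ t, √(1 - Q / Q1) / (2 * (8 * Q1 + 1)) ≤ t ∧ 0 < t ∧ t ≤ 1 / 2 ∧
      ∀ r : ℝ, ((1 - r) * n₁ t + r * p₁ t) * exp (-((1 - r) * n₂ t + r * p₂ t)) ≤ Q1 := by
  have hQ1 : 0 < Q1 := hQ.trans hQQ1
  obtain ⟨t, ht, θ, hθ, hval, hmax⟩ :=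
    exists_isMaxOn_mul_exp_neg_eq hp₁ hp₂ h₁ h₂ (h₀.trans_lt hQQ1) hexit
  have ht0 : 0 < t := by
    refine lt_of_le_of_ne ht.1 fun h => ?_
    rw [← h, h₁, h₂] at hval
    simp only [sub_self, mul_zero, add_zero] at hval
    linarith
  have htI : t ∈ Set.Ioc (0 : ℝ) (1 / 2) := ⟨ht0, ht.2⟩
  have hθ0 : 0 < θ := by
    refine lt_of_le_of_ne hθ.1 fun h => ?_
    rw [← h] at hval
    simp only [zero_mul, add_zero] at hval
    linarith
  have hθ1 : θ < 1 := by
    refine lt_of_le_of_ne hθ.2 fun h => ?_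
    rw [h] at hval
    simp only [one_mul, add_sub_cancel] at hval
    linarith [hp t htI]
  have htan := eq_mul_of_isMaxOn_mul_exp_neg ⟨hθ0, hθ1⟩ hmax
  set d₁ := p₁ t - x₀ with hd₁
  set d₂ := p₂ t - y₀ with hd₂
  have hX : 0 < x₀ + θ * d₁ := by
    by_contra! hle
    have := mul_nonpos_of_nonpos_of_nonneg hle (exp_pos (-(y₀ + θ * d₂))).le
    linarith
  have hline : ∀ r : ℝ, x₀ + r * d₁ = (x₀ + θ * d₁) * (1 + (r - θ) * d₂) ∧
      (x₀ + r * d₁) * exp (-(y₀ + r * d₂)) =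
        Q1 * (1 + (r - θ) * d₂) * exp (-((r - θ) * d₂)) := fun r => by
    have h := mul_exp_neg_eq_of_tangent (y₀ := y₀) r htan
    rwa [hval] at h
  have hs : ∀ r : ℝ, 0 < x₀ + r * d₁ → -1 < (r - θ) * d₂ := fun r hr => by
    rw [(hline r).1] at hr
    linarith [pos_of_mul_pos_right hr hX.le]
  have hlow : √(1 - Q / Q1) ≤ |(0 - θ) * d₂| := by
    refine sqrt_one_sub_div_le_abs hQ1 (hs 0 (by linarith)) ?_
    rw [← (hline 0).2]
    simpa using h₀
  set ρ := -((1 - t) / t) with hρ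
  have hn₁ : x₀ + ρ * d₁ = n₁ t := by
    have := hsp₁ t htI
    rw [hρ, hd₁]; field_simp; linarith
  have hn₂ : y₀ + ρ * d₂ = n₂ t := by
    have := hsp₂ t htI
    rw [hρ, hd₂]; field_simp; linarith
  have hup : |(ρ - θ) * d₂| ≤ 8 * Q1 + 1 := by
    refine abs_le_of_one_le_mul_exp_neg hQ1 (hs ρ ?_) ?_
    · rw [hn₁]; exact (hn t htI).1
    · rw [← (hline ρ).2, hn₁, hn₂]; exact (hn t htI).2
  refine ⟨t, ?_, ht0, ht.2, fun r => ?_⟩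
  · rw [abs_mul, zero_sub, abs_neg, abs_of_pos hθ0] at hlow
    have hρθ : |ρ - θ| = (1 - t) / t + θ := by
      rw [show ρ - θ = -((1 - t) / t + θ) by rw [hρ]; ring, abs_neg, abs_of_pos]
      have : 0 ≤ (1 - t) / t := div_nonneg (by linarith [ht.2]) ht0.le
      linarith
    rw [abs_mul, hρθ] at hup
    have hd : √(1 - Q / Q1) ≤ |d₂| := by nlinarith [abs_nonneg d₂]
    have h3 : (1 - t) / t * |d₂| ≤ 8 * Q1 + 1 := by nlinarith [abs_nonneg d₂]
    rw [div_mul_eq_mul_div, div_le_iff₀ ht0] at h3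
    rw [div_le_iff₀ (by positivity)]
    nlinarith [abs_nonneg d₂, ht.2]
  · have e₁ : (1 - r) * n₁ t + r * p₁ t = x₀ + ((1 - r) * ρ + r) * d₁ := by
      rw [← hn₁, hd₁]; ring
    have e₂ : (1 - r) * n₂ t + r * p₂ t = y₀ + ((1 - r) * ρ + r) * d₂ := by
      rw [← hn₂, hd₂]; ring
    rw [e₁, e₂, (hline _).2]
    set s := ((1 - r) * ρ + r - θ) * d₂
    have h1 : (1 + s) * exp (-s) ≤ 1 := by
      have h := mul_le_mul_of_nonneg_right (add_one_le_exp s) (exp_pos (-s)).le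
      rw [← exp_add, add_neg_cancel, exp_zero] at h
      linarith
    nlinarith

/-- A segment with endpoints in the epigraph of `exp` on which `x e^{-y} ≤ Q₁` lies in `Ω_{Q₁}`. -/
theorem segment_subset_of_exp_le {Q1 x₁ y₁ x₂ y₂ : ℝ} (h₁ : exp y₁ ≤ x₁) (h₂ : exp y₂ ≤ x₂)
    (h : ∀ r ∈ Set.Icc (0 : ℝ) 1,
      ((1 - r) * x₁ + r * x₂) * exp (-((1 - r) * y₁ + r * y₂)) ≤ Q1) :
    segment ℝ (x₁, y₁) (x₂, y₂) ⊆
      {z : ℝ × ℝ | 0 < z.1 ∧ 1 ≤ z.1 * exp (-z.2) ∧ z.1 * exp (-z.2) ≤ Q1} := by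
  rw [segment_eq_image]
  rintro _ ⟨r, hr, rfl⟩
  simp only [Prod.smul_mk, Prod.mk_add_mk, smul_eq_mul, Set.mem_ofPred_eq]
  have hc : exp ((1 - r) * y₁ + r * y₂) ≤ (1 - r) * x₁ + r * x₂ := by
    have h := convexOn_exp.2 (Set.mem_univ y₁) (Set.mem_univ y₂) (sub_nonneg.2 hr.2) hr.1
      (by ring)
    simp only [smul_eq_mul] at h
    nlinarith [mul_le_mul_of_nonneg_left h₁ (sub_nonneg.2 hr.2),
      mul_le_mul_of_nonneg_left h₂ hr.1]
  refine ⟨(exp_pos _).trans_le hc, ?_, h r hr⟩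
  rw [exp_neg, ← div_eq_mul_inv, le_div_iff₀ (exp_pos _), one_mul]
  exact hc

/-- **Splitting lemma for `A_∞`.**
Fix `Q₁ > Q > 0` and let `Ω_{Q₁} = {(x,y) : x > 0, 1 ≤ x·e^{−y} ≤ Q₁}`.
There is `α ∈ (0, 1/2]`, depending only on `Q` and `Q₁`, such that every bounded
interval `I = (a,b)` can be split at a point `c` into adjacent subintervals
`I⁻ = (a,c)`, `I⁺ = (c,b)` with `α ≤ |I⁻|/|I| ≤ 1 − α`, so that for every weight `w`
with `log w` locally integrable and `[w]_{A_∞} ≤ Q < Q₁`, the segment joining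
`x⁻ = (⟨w⟩_{I⁻}, ⟨log w⟩_{I⁻})` and `x⁺ = (⟨w⟩_{I⁺}, ⟨log w⟩_{I⁺})` lies in
`Ω_{Q₁}`. -/
theorem splitting_lemma_ainfty (Q Q1 : ℝ) (hQ : 0 < Q) (hQQ1 : Q < Q1) :
    ∃ α : ℝ, 0 < α ∧ α ≤ 1/2 ∧
      ∀ w : ℝ → ℝ, LocallyIntegrable w → (∀ᵐ t ∂volume, 0 < w t) →
        LocallyIntegrable (fun t => Real.log (w t)) →
        (∀ a b : ℝ, a < b →
          intAvg w a b * Real.exp (-(intAvg (fun t => Real.log (w t)) a b)) ≤ Q) →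
        ∀ a b : ℝ, a < b →
          ∃ c : ℝ, a < c ∧ c < b ∧
            α ≤ (c - a)/(b - a) ∧ (c - a)/(b - a) ≤ 1 - α ∧
            segment ℝ (intAvg w a c, intAvg (fun t => Real.log (w t)) a c)
                (intAvg w c b, intAvg (fun t => Real.log (w t)) c b) ⊆
              {z : ℝ × ℝ | 0 < z.1 ∧ 1 ≤ z.1 * Real.exp (-z.2) ∧
                z.1 * Real.exp (-z.2) ≤ Q1} := by
  have hQ1 : 0 < Q1 := hQ.trans hQQ1
  have hδ : 0 < √(1 - Q / Q1) :=
    Real.sqrt_pos.2 (sub_pos.2 ((div_lt_one hQ1).2 hQQ1))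
  have hδ1 : √(1 - Q / Q1) ≤ 1 :=
    Real.sqrt_le_one.2 (by linarith [div_pos hQ hQ1])
  have hα : √(1 - Q / Q1) / (2 * (8 * Q1 + 1)) ≤ 1 / 2 := by
    rw [div_le_iff₀ (by positivity)]
    linarith
  refine ⟨√(1 - Q / Q1) / (2 * (8 * Q1 + 1)), by positivity, hα, ?_⟩
  intro w hw hpos hlog hA a b hab
  set L : ℝ → ℝ := fun t => Real.log (w t) with hL
  have hba : 0 < b - a := sub_pos.2 hab
  have hJ : ∀ {x y : ℝ}, x < y → exp (intAvg L x y) ≤ intAvg w x y := fun hxy =>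
    exp_intAvg_log_le_intAvg hw hpos hlog hxy
  have hW : ∀ {x y : ℝ}, x < y → 0 < intAvg w x y := fun hxy => (exp_pos _).trans_le (hJ hxy)
  have hone : ∀ {x y : ℝ}, x < y → 1 ≤ intAvg w x y * exp (-intAvg L x y) := fun hxy => by
    rw [exp_neg, ← div_eq_mul_inv, le_div_iff₀ (exp_pos _), one_mul]
    exact hJ hxy
  by_cases hmid : ∀ r ∈ Set.Icc (0 : ℝ) 1,
      ((1 - r) * intAvg w a ((a + b) / 2) + r * intAvg w ((a + b) / 2) b) *
        exp (-((1 - r) * intAvg L a ((a + b) / 2) + r * intAvg L ((a + b) / 2) b)) ≤ Q1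
  · have hc : ((a + b) / 2 - a) / (b - a) = 1 / 2 := by field_simp; ring
    exact ⟨(a + b) / 2, by linarith, by linarith, by rw [hc]; exact hα, by rw [hc]; linarith,
      segment_subset_of_exp_le (hJ (by linarith)) (hJ (by linarith)) hmid⟩
  push Not at hmid
  obtain ⟨r, hr, hexit⟩ := hmid
  have hca : ∀ t ∈ Set.Icc (0 : ℝ) (1 / 2), a + t * (b - a) < b := fun t ht => by
    nlinarith [ht.2]
  have hcb : ∀ t ∈ Set.Icc (0 : ℝ) (1 / 2), a < b - t * (b - a) := fun t ht => by
    nlinarith [ht.2]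
  have hca' : ∀ t ∈ Set.Ioc (0 : ℝ) (1 / 2), a < a + t * (b - a) := fun t ht => by
    nlinarith [ht.1]
  have hcb' : ∀ t ∈ Set.Ioc (0 : ℝ) (1 / 2), b - t * (b - a) < b := fun t ht => by
    nlinarith [ht.1]
  have hIoc : ∀ t ∈ Set.Ioc (0 : ℝ) (1 / 2), t ∈ Set.Icc (0 : ℝ) (1 / 2) := fun t ht =>
    ⟨ht.1.le, ht.2⟩
  have hhalf : ∀ {f : ℝ → ℝ}, LocallyIntegrable f →
      intAvg f a b = 1 / 2 * intAvg f a ((a + b) / 2) + 1 / 2 * intAvg f ((a + b) / 2) b := by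
    intro f hf
    rw [intAvg_eq_weighted_add hf (show a < (a + b) / 2 by linarith) (by linarith),
      show ((a + b) / 2 - a) / (b - a) = 1 / 2 by field_simp; ring]
    ring
  have hleft : ∀ {f : ℝ → ℝ}, LocallyIntegrable f → ∀ t ∈ Set.Ioc (0 : ℝ) (1 / 2),
      intAvg f a b = t * intAvg f a (a + t * (b - a)) + (1 - t) * intAvg f (a + t * (b - a)) b := by
    intro f hf t ht
    rw [intAvg_eq_weighted_add hf (hca' t ht) (hca t (hIoc t ht)),
      show (a + t * (b - a) - a) / (b - a) = t by field_simp; ring]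
  have hright : ∀ {f : ℝ → ℝ}, LocallyIntegrable f → ∀ t ∈ Set.Ioc (0 : ℝ) (1 / 2),
      intAvg f a b = t * intAvg f (b - t * (b - a)) b + (1 - t) * intAvg f a (b - t * (b - a)) := by
    intro f hf t ht
    rw [intAvg_eq_weighted_add hf (hcb t (hIoc t ht)) (hcb' t ht),
      show (b - t * (b - a) - a) / (b - a) = 1 - t by field_simp; ring]
    ring
  have hcleft : ∀ {f : ℝ → ℝ}, LocallyIntegrable f →
      ContinuousOn (fun t => intAvg f (a + t * (b - a)) b) (Set.Icc 0 (1 / 2)) := fun hf =>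
    (continuousOn_intAvg_left hf b).comp (by fun_prop) hca
  have hcright : ∀ {f : ℝ → ℝ}, LocallyIntegrable f →
      ContinuousOn (fun t => intAvg f a (b - t * (b - a))) (Set.Icc 0 (1 / 2)) := fun hf =>
    (continuousOn_intAvg_right hf a).comp (by fun_prop) hcb
  rcases le_total (1 / 2) r with hr2 | hr2
  · obtain ⟨t, hαt, ht0, ht2, hseg⟩ := exists_segment_mul_exp_neg_le hQ hQQ1
      (n₁ := fun t => intAvg w a (a + t * (b - a))) (n₂ := fun t => intAvg L a (a + t * (b - a)))
      (hcleft hw) (hcleft hlog) (by simp) (by simp) (hW hab) (hA a b hab)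
      (fun t ht => hA _ _ (hca t (hIoc t ht)))
      (fun t ht => ⟨hW (hca' t ht), hone (hca' t ht)⟩) (hleft hw) (hleft hlog)
      ⟨2 * r - 1, ⟨by linarith, by linarith [hr.2]⟩, by
        rw [show a + 1 / 2 * (b - a) = (a + b) / 2 by ring, hhalf hw, hhalf hlog]
        exact hexit.trans_eq
          (congrArg₂ (fun x y => x * exp (-y)) (by ring) (by ring))⟩
    have ht : t ∈ Set.Ioc (0 : ℝ) (1 / 2) := ⟨ht0, ht2⟩
    have hc : (a + t * (b - a) - a) / (b - a) = t := by field_simp; ring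
    exact ⟨a + t * (b - a), hca' t ht, hca t (hIoc t ht), by rw [hc]; exact hαt,
      by rw [hc]; linarith,
      segment_subset_of_exp_le (hJ (hca' t ht)) (hJ (hca t (hIoc t ht))) fun r _ => hseg r⟩
  · obtain ⟨t, hαt, ht0, ht2, hseg⟩ := exists_segment_mul_exp_neg_le hQ hQQ1
      (n₁ := fun t => intAvg w (b - t * (b - a)) b) (n₂ := fun t => intAvg L (b - t * (b - a)) b)
      (hcright hw) (hcright hlog) (by simp) (by simp) (hW hab) (hA a b hab)
      (fun t ht => hA _ _ (hcb t (hIoc t ht)))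
      (fun t ht => ⟨hW (hcb' t ht), hone (hcb' t ht)⟩) (hright hw) (hright hlog)
      ⟨1 - 2 * r, ⟨by linarith, by linarith [hr.1]⟩, by
        rw [show b - 1 / 2 * (b - a) = (a + b) / 2 by ring, hhalf hw, hhalf hlog]
        exact hexit.trans_eq
          (congrArg₂ (fun x y => x * exp (-y)) (by ring) (by ring))⟩
    have ht : t ∈ Set.Ioc (0 : ℝ) (1 / 2) := ⟨ht0, ht2⟩
    have hc : (b - t * (b - a) - a) / (b - a) = 1 - t := by field_simp; ring
    refine ⟨b - t * (b - a), hcb t (hIoc t ht), hcb' t ht, by rw [hc]; linarith,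
      by rw [hc]; linarith, ?_⟩
    rw [segment_symm]
    exact segment_subset_of_exp_le (hJ (hcb' t ht)) (hJ (hcb t (hIoc t ht))) fun r _ => hseg r
end

section
/- (Bounds for the Bellman function of Theorem 1.1.) Let Q > 1 and let γ ∈ (0,1) satisfy γ − log γ = 1 + log Q. Suppose x > 0 and y ∈ ℝ satisfy 1 ≤ x·e^{−y} ≤ Q, and suppose v satisfies γ·x ≤ v ≤ x and y = γ·x/v + log v − γ. Then, with B = x·log v + (x − v)/γ, one has x·log x ≤ B ≤ x·log x + (log γ + 1/γ − 1)·x, and moreover log γ + 1/γ − 1 ≤ e·Q. -/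
open Real

/-- **Bounds for the Bellman function of Theorem 1.1.**
Let `Q > 1` and let `γ ∈ (0,1)` satisfy `γ − log γ = 1 + log Q`. Suppose `x > 0` and
`y` satisfy `1 ≤ x·e^{−y} ≤ Q`, and `v` satisfies `γ·x ≤ v ≤ x` and
`y = γ·x/v + log v − γ`. Then, with `B = x·log v + (x − v)/γ`, one has
`x·log x ≤ B ≤ x·log x + (log γ + 1/γ − 1)·x`, and `log γ + 1/γ − 1 ≤ e·Q`. -/
theorem bellman_function_bounds
    (Q : ℝ) (hQ : 1 < Q)
    (γ : ℝ) (hγ : γ ∈ Set.Ioo (0:ℝ) 1)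
    (hγroot : γ - Real.log γ = 1 + Real.log Q)
    (x y : ℝ) (hx : 0 < x)
    (hdom1 : 1 ≤ x * Real.exp (-y)) (hdom2 : x * Real.exp (-y) ≤ Q)
    (v : ℝ) (hv1 : γ * x ≤ v) (hv2 : v ≤ x)
    (hvy : y = γ * x / v + Real.log v - γ) :
    x * Real.log x ≤ x * Real.log v + (x - v)/γ ∧
    x * Real.log v + (x - v)/γ ≤ x * Real.log x + (Real.log γ + 1/γ - 1) * x ∧
    Real.log γ + 1/γ - 1 ≤ Real.exp 1 * Q := by
  obtain ⟨hγ0, hγ1⟩ := hγ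
  have hv : 0 < v := lt_of_lt_of_le (by positivity) hv1
  refine ⟨?_, ?_, ?_⟩
  · have h := Real.log_le_sub_one_of_pos (div_pos hx hv)
    rw [Real.log_div hx.ne' hv.ne'] at h
    have h2 : (x - v) / v ≤ (x - v) / (γ * x) :=
      div_le_div_of_nonneg_left (sub_nonneg.2 hv2) (by positivity) hv1
    have h3 : (x - v) / v = x / v - 1 := by field_simp
    have h4 : x * ((x - v) / (γ * x)) = (x - v) / γ := by field_simp
    have h5 := mul_le_mul_of_nonneg_left
      (show Real.log x - Real.log v ≤ (x - v) / (γ * x) by linarith) hx.le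
    linarith
  · have hγx : 0 < γ * x := by positivity
    have h := Real.log_le_sub_one_of_pos (div_pos hv hγx)
    rw [Real.log_div hv.ne' hγx.ne', Real.log_mul hγ0.ne' hx.ne'] at h
    have h2 := mul_le_mul_of_nonneg_left h hx.le
    have h3 : x * (v / (γ * x) - 1) = v / γ - x := by field_simp
    have h4 : (x - v) / γ = 1 / γ * x - v / γ := by ring
    linarith
  · have h : 1 / γ = Real.exp (-Real.log γ) := by
      rw [Real.exp_neg, Real.exp_log hγ0, one_div]
    have h2 : Real.exp (-Real.log γ) ≤ Real.exp (1 + Real.log Q) :=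
      Real.exp_le_exp.2 (by linarith)
    rw [Real.exp_add, Real.exp_log (by linarith : 0 < Q)] at h2
    have h3 := Real.log_nonpos hγ0.le hγ1.le
    linarith
end

section
/- (Tangent lines to the upper boundary curve.) Let Q > 0 and let γ_+ > 1 be the larger root of γ − log γ = Q + 1. For v > 0, consider the line ℓ_v given by y = (log v + γ_+)·x − v·γ_+ and the curve Γ_Q = {(x, x·log x + Q·x) : x > 0}. Then: (i) ℓ_v passes through (v, v·log v); (ii) setting a_v = γ_+·v, the point (a_v, a_v·log a_v + Q·a_v) lies on ℓ_v, and the slope of ℓ_v equals the derivative log(a_v) + 1 + Q of x ↦ x·log x + Q·x at x = a_v (so ℓ_v is tangent to Γ_Q there); (iii) (a_v, a_v·log a_v + Q·a_v) is the unique point of ℓ_v ∩ Γ_Q. -/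
open Real

/-- **Tangent lines to the upper boundary curve `Γ_Q`.**
Let `Q > 0`, let `γ₊ > 1` be the larger root of `γ − log γ = Q + 1`, and let `v > 0`.
Consider the line `ℓ_v : y = (log v + γ₊)·x − v·γ₊` and the curve
`Γ_Q = {(x, x log x + Q x) : x > 0}`. Then:
(i) `ℓ_v` passes through `(v, v log v)`;
(ii) with `a_v = γ₊ v`, the point `(a_v, a_v log a_v + Q a_v)` lies on `ℓ_v` and the
slope `log v + γ₊` of `ℓ_v` equals the derivative `log a_v + 1 + Q` of
`x ↦ x log x + Q x` at `a_v` (tangency);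
(iii) `(a_v, a_v log a_v + Q a_v)` is the unique point of `ℓ_v ∩ Γ_Q`. -/
theorem tangent_line_to_upper_boundary
    (Q : ℝ) (hQ : 0 < Q) (γp : ℝ) (hγp : 1 < γp)
    (hroot : γp - Real.log γp = Q + 1)
    (v : ℝ) (hv : 0 < v) :
    (v * Real.log v = (Real.log v + γp) * v - v * γp) ∧
    ((γp * v) * Real.log (γp * v) + Q * (γp * v) = (Real.log v + γp) * (γp * v) - v * γp ∧
      Real.log v + γp = Real.log (γp * v) + 1 + Q) ∧
    (∀ x : ℝ, 0 < x →
      x * Real.log x + Q * x = (Real.log v + γp) * x - v * γp → x = γp * v) := by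
  have hγ0 : 0 < γp := by linarith
  have hlog : Real.log (γp * v) = Real.log γp + Real.log v :=
    Real.log_mul hγ0.ne' hv.ne'
  have hQ_eq : Q = γp - Real.log γp - 1 := by linarith
  refine ⟨by ring, ⟨by rw [hlog, hQ_eq]; ring, by rw [hlog, hQ_eq]; ring⟩, fun x hx h => ?_⟩
  have ha : 0 < γp * v := mul_pos hγ0 hv
  by_contra hne
  have hratio : γp * v / x ≠ 1 := fun h1 => hne ((div_eq_one_iff_eq hx.ne').mp h1).symm
  have hlt := Real.log_lt_sub_one_of_pos (div_pos ha hx) hratio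
  rw [Real.log_div ha.ne' hx.ne', hlog] at hlt
  have hmul := mul_lt_mul_of_pos_left hlt hx
  have hcancel : x * (γp * v / x - 1) = γp * v - x := by field_simp
  rw [hcancel] at hmul
  rw [hQ_eq] at h
  linarith
end

section
/- For every s ∈ (0,1) and every γ ≥ 1, one has (γ − 1)·s·log s − (1 − s)·log((1 − s)/(1 − s^γ)) ≤ 0. -/
open Real

/-- For every `s ∈ (0,1)` and every `γ ≥ 1`,
`(γ − 1)·s·log s − (1 − s)·log((1 − s)/(1 − s^γ)) ≤ 0`. -/
theorem key_elementary_inequality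
    (s γ : ℝ) (hs : s ∈ Set.Ioo (0:ℝ) 1) (hγ : 1 ≤ γ) :
    (γ - 1) * s * Real.log s - (1 - s) * Real.log ((1 - s)/(1 - s ^ γ)) ≤ 0 := by
  obtain ⟨h0, h1⟩ := hs
  have hpos : 0 < 1 - s := sub_pos.2 h1
  have hpow : 0 < 1 - s ^ γ := sub_pos.2 (Real.rpow_lt_one h0.le h1 (by linarith))
  have hfirst : s * ((γ - 1) * Real.log s) ≤ s ^ γ - s := by
    have h := Real.log_le_sub_one_of_pos (Real.rpow_pos_of_pos h0 (γ - 1))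
    rw [Real.log_rpow h0, Real.rpow_sub_one h0.ne'] at h
    calc s * ((γ - 1) * Real.log s) ≤ s * (s ^ γ / s - 1) := by gcongr
      _ = s ^ γ - s := by field_simp
  have hsecond : (1 - s) * Real.log ((1 - s ^ γ) / (1 - s)) ≤ s - s ^ γ := by
    calc (1 - s) * Real.log ((1 - s ^ γ) / (1 - s))
        ≤ (1 - s) * ((1 - s ^ γ) / (1 - s) - 1) := by
          gcongr
          exact Real.log_le_sub_one_of_pos (div_pos hpow hpos)
      _ = s - s ^ γ := by
          rw [mul_sub, mul_div_cancel₀ _ hpos.ne']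
          ring
  rw [← inv_div (1 - s ^ γ), Real.log_inv]
  linarith
end

section
/- Let Q > 0 and let γ_− ∈ (0,1) be the smaller root of t − log t = Q + 1. Define w on (0,1] by w(t) = (1/γ_−)·t^{(1−γ_−)/γ_−}. Then the RH_1 constant of w on [0,1] equals Q, and ⟨w⟩_{[0,1]}·exp(−⟨log w⟩_{[0,1]}) = γ_−·exp((1 − γ_−)/γ_−). (This shows the bound [w]_{A_∞} ≤ γ_−·exp((1−γ_−)/γ_−) for weights with [w]_{RH_1} ≤ Q is sharp.) -/
open MeasureTheory Real

theorem intAvg_congr {f g : ℝ → ℝ} {a b : ℝ} (hab : a ≤ b) (h : Set.EqOn f g (Set.Ioc a b)) :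
    intAvg f a b = intAvg g a b := by
  unfold intAvg
  congr 1
  refine intervalIntegral.integral_congr_ae (Filter.Eventually.of_forall fun t ht => h ?_)
  rwa [Set.uIoc_of_le hab] at ht

theorem intAvg_mul_rpow {p : ℝ} (hp : 0 < p) (a b : ℝ) :
    intAvg (fun t => p * t ^ (p - 1)) a b = (b ^ p - a ^ p) / (b - a) := by
  unfold intAvg
  rw [intervalIntegral.integral_const_mul, integral_rpow (Or.inl (by linarith)), sub_add_cancel]
  field_simp

/-- The two-term log-sum inequality, written for `A = B + (A - B)` and `b = a + (b - a)`. -/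
theorem log_sum_inequality {A B a b : ℝ} (ha : 0 < a) (hab : a < b) (hB : 0 < B) (hAB : B < A) :
    A * Real.log (A / b) - B * Real.log (B / a) ≤
      (A - B) * Real.log ((A - B) / (b - a)) := by
  have hA : 0 < A := hB.trans hAB
  have hb : 0 < b := ha.trans hab
  have key : ∀ {x y : ℝ}, 0 < x → 0 < y →
      x - y * (A / b) ≤ x * (Real.log (x / y) - Real.log (A / b)) := by
    intro x y hx hy
    rw [← Real.log_div (by positivity) (by positivity)]
    calc x - y * (A / b) = x * (1 - (x / y / (A / b))⁻¹) := by field_simp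
      _ ≤ _ := mul_le_mul_of_nonneg_left (Real.one_sub_inv_le_log_of_pos (by positivity)) hx.le
  have h1 := key hB ha
  have h2 := key (sub_pos.2 hAB) (sub_pos.2 hab)
  have h3 : b * (A / b) = A := by field_simp
  linarith

/-- The interval-wise entropy of the density `p * t ^ (p - 1)`, normalized by `m`. -/
theorem intAvg_mul_log_rpow {p m a b : ℝ} (hp : 1 < p) (hm : 0 < m) (ha : 0 ≤ a) (hab : a ≤ b) :
    intAvg (fun t => (p * t ^ (p - 1) / m) * Real.log (p * t ^ (p - 1) / m)) a b =
      (b - a)⁻¹ * (((b ^ p - a ^ p) * (Real.log p - Real.log m - (p - 1) / p) +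
        (p - 1) / p * (b ^ p * Real.log (b ^ p) - a ^ p * Real.log (a ^ p))) / m) := by
  have hp0 : 0 < p := by linarith
  have hc (r : ℝ) (hr : 0 < r) : Continuous fun t : ℝ => t ^ r :=
    Real.continuous_rpow_const hr.le
  unfold intAvg
  congr 1
  rw [intervalIntegral.integral_eq_sub_of_hasDerivAt_of_le
    (f := fun t => (t ^ p * (Real.log p - Real.log m - (p - 1) / p) +
      (p - 1) / p * (t ^ p * Real.log (t ^ p))) / m) hab]
  · ring
  · have h1 := hc p hp0
    have h2 : Continuous fun t : ℝ => t ^ p * Real.log (t ^ p) := Real.continuous_mul_log.comp h1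
    fun_prop
  · intro t ht
    have ht0 : 0 < t := ha.trans_lt ht.1
    have htp : 0 < t ^ p := by positivity
    have h1 := Real.hasDerivAt_rpow_const (x := t) (p := p) (Or.inl ht0.ne')
    have h2 := (Real.hasDerivAt_mul_log htp.ne').comp t h1
    refine (((h1.mul_const (Real.log p - Real.log m - (p - 1) / p)).add
      (h2.const_mul ((p - 1) / p))).div_const m).congr_deriv ?_
    rw [Real.log_div (by positivity) hm.ne', Real.log_mul hp0.ne' (by positivity),
      Real.log_rpow ht0, Real.log_rpow ht0]
    field_simp
    ring
  · refine Continuous.intervalIntegrable ?_ _ _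
    have h1 := hc (p - 1) (by linarith)
    have h2 : Continuous fun t : ℝ => p * t ^ (p - 1) / m := by fun_prop
    exact Real.continuous_mul_log.comp h2

theorem intAvg_log_mul_rpow {p : ℝ} (hp : 0 < p) :
    intAvg (fun t => Real.log (p * t ^ (p - 1))) 0 1 = Real.log p - (p - 1) := by
  rw [intAvg_congr zero_le_one (g := fun t => Real.log p + (p - 1) * Real.log t)]
  · unfold intAvg
    rw [intervalIntegral.integral_add (by simp)
      (intervalIntegral.intervalIntegrable_log'.const_mul _)]
    simp
    ring
  · intro t ht
    have ht0 : 0 < t := ht.1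
    simp only
    rw [Real.log_mul hp.ne' (by positivity), Real.log_rpow ht0]

theorem intAvg_mul_log_rpow_le {p a b : ℝ} (hp : 1 < p) (ha : 0 ≤ a) (hab : a < b) :
    intAvg (fun t => (p * t ^ (p - 1) / ((b ^ p - a ^ p) / (b - a))) *
      Real.log (p * t ^ (p - 1) / ((b ^ p - a ^ p) / (b - a)))) a b ≤
      Real.log p - (p - 1) / p := by
  have hp0 : 0 < p := by linarith
  have hb : 0 < b := ha.trans_lt hab
  have hAB : 0 < b ^ p - a ^ p := sub_pos.2 (Real.rpow_lt_rpow ha hab hp0)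
  have hba : 0 < b - a := sub_pos.2 hab
  rw [intAvg_mul_log_rpow hp (div_pos hAB hba) ha hab.le]
  have key : (p - 1) / p * (b ^ p * Real.log (b ^ p) - a ^ p * Real.log (a ^ p)) ≤
      (b ^ p - a ^ p) * Real.log ((b ^ p - a ^ p) / (b - a)) := by
    have hlog : ∀ {x : ℝ}, 0 < x →
        (p - 1) / p * (x ^ p * Real.log (x ^ p)) = x ^ p * Real.log (x ^ p / x) := by
      intro x hx
      rw [Real.log_div (by positivity) hx.ne', Real.log_rpow hx]
      field_simp
    rw [mul_sub, hlog hb]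
    rcases ha.eq_or_lt with rfl | ha
    · simp [Real.zero_rpow hp0.ne']
    · rw [hlog ha]
      exact log_sum_inequality ha hab (by positivity) (sub_pos.1 hAB)
  rw [inv_mul_eq_div, div_div, div_mul_cancel₀ _ hba.ne', div_le_iff₀ hAB]
  linarith

/-- **Sharpness of the bound `[w]_{A_∞} ≤ γ₋·exp((1−γ₋)/γ₋)`.**
Let `Q > 0`, let `γ₋ ∈ (0,1)` be the smaller root of `t − log t = Q + 1`, and let
`w(t) = (1/γ₋)·t^{(1−γ₋)/γ₋}` on `(0,1]`. Then the `RH₁` constant of `w` on `[0,1]`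
equals `Q` (it is the least upper bound of the interval-wise `RH₁` quantities), and
`⟨w⟩_{[0,1]}·exp(−⟨log w⟩_{[0,1]}) = γ₋·exp((1 − γ₋)/γ₋)`. -/
theorem sharpness_ainfty_bound
    (Q : ℝ) (hQ : 0 < Q) (γm : ℝ) (hγm : γm ∈ Set.Ioo (0:ℝ) 1)
    (hroot : γm - Real.log γm = Q + 1)
    (w : ℝ → ℝ) (hwdef : ∀ t ∈ Set.Ioc (0:ℝ) 1, w t = (1/γm) * t ^ ((1-γm)/γm)) :
    IsLUB {c : ℝ | ∃ a b : ℝ, 0 ≤ a ∧ a < b ∧ b ≤ 1 ∧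
        c = intAvg (fun t => (w t / intAvg w a b) * Real.log (w t / intAvg w a b)) a b}
      Q ∧
    intAvg w 0 1 * Real.exp (-(intAvg (fun t => Real.log (w t)) 0 1)) =
      γm * Real.exp ((1 - γm)/γm) := by
  obtain ⟨hγ0, hγ1⟩ := hγm
  obtain ⟨p, hpdef⟩ : ∃ p, p = 1 / γm := ⟨_, rfl⟩
  have hp : 1 < p := by rw [hpdef]; exact one_lt_one_div hγ0 hγ1
  have hp0 : 0 < p := by linarith
  have hexp : (1 - γm) / γm = p - 1 := by rw [hpdef]; field_simp
  have hlogp : Real.log p = -Real.log γm := by rw [hpdef, one_div, Real.log_inv]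
  have hQp : Q = Real.log p - (p - 1) / p := by
    have : (p - 1) / p = 1 - γm := by rw [hpdef]; field_simp
    linarith
  rw [← hpdef, hexp] at hwdef
  have hw : ∀ {a b : ℝ}, 0 ≤ a → b ≤ 1 →
      Set.EqOn w (fun t => p * t ^ (p - 1)) (Set.Ioc a b) := fun ha hb t ht =>
    hwdef t ⟨ha.trans_lt ht.1, ht.2.trans hb⟩
  have havg : ∀ {a b : ℝ}, 0 ≤ a → a < b → b ≤ 1 →
      intAvg w a b = (b ^ p - a ^ p) / (b - a) := fun ha hab hb => by
    rw [intAvg_congr hab.le (hw ha hb), intAvg_mul_rpow hp0]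
  have hent : ∀ {a b : ℝ} (m : ℝ), 0 ≤ a → a < b → b ≤ 1 →
      intAvg (fun t => (w t / m) * Real.log (w t / m)) a b =
        intAvg (fun t => (p * t ^ (p - 1) / m) * Real.log (p * t ^ (p - 1) / m)) a b :=
    fun m ha hab hb => intAvg_congr hab.le fun t ht => by simp only [hw ha hb ht]
  have hone : intAvg w 0 1 = 1 := by
    rw [havg le_rfl one_pos le_rfl]; simp [Real.zero_rpow hp0.ne']
  refine ⟨⟨?_, ?_⟩, ?_⟩
  · rintro c ⟨a, b, ha, hab, hb, rfl⟩
    rw [hent _ ha hab hb, havg ha hab hb, hQp]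
    exact intAvg_mul_log_rpow_le hp ha hab
  · refine fun u hu => hu ⟨0, 1, le_rfl, one_pos, le_rfl, ?_⟩
    rw [hent _ le_rfl one_pos le_rfl, hone,
      intAvg_mul_log_rpow hp one_pos le_rfl zero_le_one, hQp]
    simp [Real.zero_rpow hp0.ne']
  · rw [hone, intAvg_congr zero_le_one (g := fun t => Real.log (p * t ^ (p - 1)))
      (fun t ht => by simp only [hw le_rfl le_rfl ht]), intAvg_log_mul_rpow hp0, hexp, hlogp,
      one_mul, show -(-Real.log γm - (p - 1)) = Real.log γm + (p - 1) by ring,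
      Real.exp_add, Real.exp_log hγ0]
end

section
/- (RH_1 as the limit of the RH_p conditions.) Let I ⊂ ℝ be a bounded interval of positive length and let w be a measurable function on I with w > 0 almost everywhere, ∫_I w > 0, and ∫_I w^{p_0} < ∞ for some p_0 > 1. Then lim_{p→1⁺} (p/(p−1))·log((⟨w^p⟩_I)^{1/p}/⟨w⟩_I) = ⟨(w/⟨w⟩_I)·log(w/⟨w⟩_I)⟩_I. -/
open MeasureTheory Real Filter

lemma Real.mul_log_le_slope_rpow {x p : ℝ} (hx : 0 < x) (hp : 1 < p) :
    x * log x ≤ (x ^ p - x) / (p - 1) := by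
  rw [le_div_iff₀ (sub_pos.2 hp)]
  have h : x ^ p = x * exp (log x * (p - 1)) := by
    rw [← rpow_def_of_pos hx, ← rpow_one_add' hx.le (by linarith), add_sub_cancel]
  nlinarith [add_one_le_exp (log x * (p - 1))]

lemma Real.slope_rpow_le_slope_rpow {x p q : ℝ} (hx : 0 < x) (hp : 1 < p) (hpq : p ≤ q) :
    (x ^ p - x) / (p - 1) ≤ (x ^ q - x) / (q - 1) := by
  have hq : 0 < q - 1 := by linarith
  have h := geom_mean_le_arith_mean2_weighted (w₁ := (q - p) / (q - 1))
    (w₂ := (p - 1) / (q - 1)) (div_nonneg (by linarith) hq.le) (div_nonneg (by linarith) hq.le)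
    hx.le (rpow_pos_of_pos hx q).le (by field_simp; ring)
  rw [← rpow_mul hx.le, ← rpow_add hx] at h
  have he : (q - p) / (q - 1) + q * ((p - 1) / (q - 1)) = p := by field_simp; ring
  rw [he] at h
  rw [div_le_iff₀ (sub_pos.2 hp)]
  refine (sub_le_sub_right h x).trans_eq ?_
  field_simp
  ring

lemma Real.neg_one_le_mul_log {x : ℝ} (hx : 0 < x) : -1 ≤ x * log x := by
  have h := mul_le_mul_of_nonneg_left (one_sub_inv_le_log_of_pos hx) hx.le
  rw [mul_sub, mul_inv_cancel₀ hx.ne'] at h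
  linarith

section
variable {α : Type*} [MeasurableSpace α] {μ : Measure α} {w : α → ℝ} {q : ℝ}

lemma MeasureTheory.Integrable.mul_log_of_rpow [IsFiniteMeasure μ] (hpos : ∀ᵐ t ∂μ, 0 < w t)
    (hw : Integrable w μ) (hq : 1 < q) (hwq : Integrable (fun t => w t ^ q) μ) :
    Integrable (fun t => w t * log (w t)) μ := by
  refine integrable_of_le_of_le
    (hw.1.mul (measurable_log.comp_aemeasurable hw.1.aemeasurable).aestronglyMeasurable) ?_ ?_
    (integrable_const (-1 : ℝ)) ((hwq.sub hw).div_const (q - 1))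
  · filter_upwards [hpos] with t ht using neg_one_le_mul_log ht
  · filter_upwards [hpos] with t ht using mul_log_le_slope_rpow ht hq

lemma MeasureTheory.Integrable.rpow_of_le_of_le (hpos : ∀ᵐ t ∂μ, 0 < w t)
    (hw : Integrable w μ) (hwq : Integrable (fun t => w t ^ q) μ) {p : ℝ} (hp : 1 < p) (hpq : p ≤ q) :
    Integrable (fun t => w t ^ p) μ := by
  refine integrable_of_le_of_le (hw.1.aemeasurable.pow_const p).aestronglyMeasurable ?_ ?_
    (integrable_zero α ℝ μ) ((((hwq.sub hw).div_const (q - 1)).mul_const (p - 1)).add hw)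
  · filter_upwards [hpos] with t ht using (rpow_pos_of_pos ht p).le
  · filter_upwards [hpos] with t ht
    have h := slope_rpow_le_slope_rpow ht hp hpq
    rw [div_le_iff₀ (sub_pos.2 hp)] at h
    simp only [Pi.add_apply, Pi.sub_apply]
    linarith

lemma hasDerivWithinAt_integral_rpow_one [IsFiniteMeasure μ] (hpos : ∀ᵐ t ∂μ, 0 < w t)
    (hw : Integrable w μ) (hq : 1 < q) (hwq : Integrable (fun t => w t ^ q) μ) :
    HasDerivWithinAt (fun p : ℝ => ∫ t, w t ^ p ∂μ) (∫ t, w t * log (w t) ∂μ) (Set.Ioi 1) 1 := by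
  rw [hasDerivWithinAt_iff_tendsto_slope' (by simp)]
  have hmem : ∀ᶠ p in nhdsWithin (1 : ℝ) (Set.Ioi 1), p ∈ Set.Ioc 1 q :=
    Ioc_mem_nhdsGT hq
  have hlim : Tendsto (fun p : ℝ => ∫ t, (w t ^ p - w t) / (p - 1) ∂μ)
      (nhdsWithin 1 (Set.Ioi 1)) (nhds (∫ t, w t * log (w t) ∂μ)) := by
    refine tendsto_integral_filter_of_dominated_convergence
      (fun t => 1 + |(w t ^ q - w t) / (q - 1)|) ?_ ?_
      ((integrable_const _).add ((hwq.sub hw).div_const (q - 1)).abs) ?_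
    · exact .of_forall fun p => (((hw.1.aemeasurable.pow_const p).sub
        hw.1.aemeasurable).div_const _).aestronglyMeasurable
    · filter_upwards [hmem] with p hp
      filter_upwards [hpos] with t ht
      have h₁ := slope_rpow_le_slope_rpow ht hp.1 hp.2
      have h₂ := (neg_one_le_mul_log ht).trans (mul_log_le_slope_rpow ht hp.1)
      rw [Real.norm_eq_abs, abs_le]
      constructor
      · linarith [abs_nonneg ((w t ^ q - w t) / (q - 1))]
      · linarith [le_abs_self ((w t ^ q - w t) / (q - 1))]
    · filter_upwards [hpos] with t ht
      have h := (hasStrictDerivAt_const_rpow ht 1).hasDerivAt.hasDerivWithinAt (s := Set.Ioi 1)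
      rw [hasDerivWithinAt_iff_tendsto_slope' (by simp)] at h
      simpa [slope_fun_def_field] using h
  refine hlim.congr' ?_
  filter_upwards [hmem] with p hp
  rw [integral_div, integral_sub (hw.rpow_of_le_of_le hpos hwq hp.1 hp.2) hw]
  simp [slope_def_field]

end

/-- **`RH₁` as the limit of the `RH_p` conditions.**
Let `I = (a,b)` be a bounded interval of positive length and `w` a measurable function
on `I` with `w > 0` a.e., `∫_I w > 0` and `∫_I w^{p₀} < ∞` for some `p₀ > 1`. Then
`(p/(p−1))·log((⟨wᵖ⟩_I)^{1/p}/⟨w⟩_I) → ⟨(w/⟨w⟩_I)·log(w/⟨w⟩_I)⟩_I` as `p → 1⁺`. -/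
theorem rh1_limit_of_rhp
    (a b : ℝ) (hab : a < b) (w : ℝ → ℝ)
    (hmeas : AEStronglyMeasurable w (volume.restrict (Set.Ioc a b)))
    (hpos : ∀ᵐ t ∂(volume.restrict (Set.Ioc a b)), 0 < w t)
    (hint : 0 < ∫ t in a..b, w t)
    (p0 : ℝ) (hp0 : 1 < p0)
    (hintp : IntegrableOn (fun t => w t ^ p0) (Set.Ioc a b)) :
    Filter.Tendsto
      (fun p : ℝ =>
        (p/(p-1)) * Real.log ((intAvg (fun t => w t ^ p) a b) ^ (1/p) / intAvg w a b))
      (nhdsWithin 1 (Set.Ioi 1))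
      (nhds (intAvg (fun t =>
        (w t / intAvg w a b) * Real.log (w t / intAvg w a b)) a b)) := by
  have hba : 0 < b - a := sub_pos.2 hab
  have hwint : Integrable w (volume.restrict (Set.Ioc a b)) := by
    rw [intervalIntegral.integral_of_le hab.le] at hint
    exact not_imp_comm.1 integral_undef hint.ne'
  set m := intAvg w a b with hm
  have hm0 : 0 < m := mul_pos (inv_pos.2 hba) hint
  have hF : HasDerivWithinAt (fun p : ℝ => intAvg (fun t => w t ^ p) a b)
      (intAvg (fun t => w t * log (w t)) a b) (Set.Ioi 1) 1 := by
    simp only [intAvg, intervalIntegral.integral_of_le hab.le]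
    exact (hasDerivWithinAt_integral_rpow_one hpos hwint hp0 hintp).const_mul _
  have hF1 : intAvg (fun t => w t ^ (1 : ℝ)) a b = m := by simp [hm]
  have hG := (hF.log (by rw [hF1]; exact hm0.ne')).sub
    ((hasDerivWithinAt_id (1 : ℝ) (Set.Ioi 1)).mul_const (log m))
  rw [hasDerivWithinAt_iff_tendsto_slope' (by simp), hF1] at hG
  have hlim : intAvg (fun t => (w t / m) * log (w t / m)) a b =
      intAvg (fun t => w t * log (w t)) a b / m - 1 * log m := by
    have hcongr : ∫ t in Set.Ioc a b, (w t / m) * log (w t / m) =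
        ∫ t in Set.Ioc a b, (w t * log (w t) / m - w t * (log m / m)) := by
      refine integral_congr_ae ?_
      filter_upwards [hpos] with t ht
      rw [log_div ht.ne' hm0.ne']
      ring
    have hlog := hwint.mul_log_of_rpow hpos hp0 hintp
    have hw : ∫ t in Set.Ioc a b, w t = m * (b - a) := by
      rw [hm, intAvg, intervalIntegral.integral_of_le hab.le]
      field_simp
    simp only [intAvg, intervalIntegral.integral_of_le hab.le]
    rw [hcongr, integral_sub (hlog.div_const m) (hwint.mul_const _), integral_div,
      integral_mul_const, hw]
    field_simp
  rw [hlim]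
  refine hG.congr' ?_
  have hFpos : ∀ᶠ p in nhdsWithin (1 : ℝ) (Set.Ioi 1), 0 < intAvg (fun t => w t ^ p) a b :=
    hF.continuousWithinAt.eventually (lt_mem_nhds (hm0.trans_eq hF1.symm))
  filter_upwards [hFpos, self_mem_nhdsWithin] with p hp hp1
  have hp1' : 0 < p - 1 := sub_pos.2 hp1
  have hp' : 0 < p := by linarith
  rw [log_div (rpow_pos_of_pos hp _).ne' hm0.ne', log_rpow hp]
  simp only [slope_def_field, Pi.sub_apply, id_eq, hF1]
  field_simp
  ring
end
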